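/- arXiv:0712.4359 — 10 statements merged into one kernel-verified Lean document; each statement's English description precedes it below -/
import Mathlib

section
/- Let n ≥ 1 and let (ω_ℓ)_{ℓ∈ℕ} be a sequence of vectors in ℝ^n that is linearly independent over ℚ (ℝ^n viewed as a ℚ-vector space). Then the additive subgroup 𝔾 = {x ∈ ℝ^ℕ : there exist t ∈ ℝ^n and p : ℕ → ℤ with x_ℓ = ⟨t, ω_ℓ⟩ + 2π p_ℓ for every ℓ ∈ ℕ} is dense in the product space ℝ^ℕ (product topology). -/
open MeasureTheory BoundedContinuousFunction

/-- Finite measures are determined by their integrals against a group of characters that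
separates points. -/
theorem ext_of_forall_integral_character_eq {G : Type*} [Group G] [PseudoEMetricSpace G]
    [CompleteSpace G] [SecondCountableTopology G] [MeasurableSpace G] [BorelSpace G]
    {P P' : Measure G} [IsFiniteMeasure P] [IsFiniteMeasure P'] (S : Subgroup (G →ₜ* Circle))
    (hsep : ∀ x y : G, x ≠ y → ∃ χ ∈ S, χ x ≠ χ y)
    (h : ∀ χ ∈ S, ∫ x, (χ x : ℂ) ∂P = ∫ x, (χ x : ℂ) ∂P') : P = P' := by
  let c : (G →ₜ* Circle) →* (G →ᵇ ℂ) :=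
    { toFun χ := .ofNormedAddCommGroup (fun x ↦ (χ x : ℂ))
        (continuous_subtype_val.comp χ.continuous_toFun) 1 fun x ↦ (Circle.norm_coe _).le
      map_one' := by ext; simp
      map_mul' χ ψ := by ext; simp }
  have c_apply (χ : G →ₜ* Circle) (x : G) : c χ x = (χ x : ℂ) := rfl
  have star_c (χ : G →ₜ* Circle) : star (c χ) = c χ⁻¹ := by
    ext x
    exact (Circle.coe_inv_eq_conj (χ x)).symm
  let M : Submonoid (G →ᵇ ℂ) := S.toSubmonoid.map c
  have star_M : star (M : Set (G →ᵇ ℂ)) ⊆ M := by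
    rintro f ⟨χ, hχ, hf⟩
    exact ⟨χ⁻¹, S.inv_mem hχ, by rw [← star_c, hf, star_star]⟩
  have adjoin_M : (StarAlgebra.adjoin ℂ (M : Set (G →ᵇ ℂ))).toSubalgebra =
      Algebra.adjoin ℂ (M : Set (G →ᵇ ℂ)) := by
    rw [StarAlgebra.adjoin_toSubalgebra, Set.union_eq_left.2 star_M]
  refine ext_of_forall_mem_subalgebra_integral_eq_of_pseudoEMetric_complete_countable (𝕜 := ℂ)
    (A := StarAlgebra.adjoin ℂ (M : Set (G →ᵇ ℂ))) ?_ ?_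
  · intro x y hxy
    obtain ⟨χ, hχ, hne⟩ := hsep x y hxy
    refine ⟨c χ, ⟨_, ⟨c χ, StarAlgebra.subset_adjoin _ _ ⟨χ, hχ, rfl⟩, rfl⟩, rfl⟩, ?_⟩
    exact fun h ↦ hne (Circle.ext h)
  · intro f hf
    rw [← StarSubalgebra.mem_toSubalgebra, adjoin_M, ← Subalgebra.mem_toSubmodule,
      Algebra.adjoin_eq_span, Submonoid.closure_eq] at hf
    induction hf using Submodule.span_induction with
    | mem f hf =>
      obtain ⟨χ, hχ, rfl⟩ := hf
      exact h χ hχ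
    | zero => simp
    | add f g _ _ hf hg =>
      simp only [BoundedContinuousFunction.coe_add, Pi.add_apply]
      rw [integral_add (f.integrable _) (g.integrable _),
        integral_add (f.integrable _) (g.integrable _), hf, hg]
    | smul a f _ hf =>
      simp only [BoundedContinuousFunction.coe_smul, integral_smul, hf]

/-- The integral of a nontrivial character against a left-invariant measure vanishes. -/
theorem integral_character_eq_zero {G : Type*} [Group G] [TopologicalSpace G] [MeasurableSpace G]
    [MeasurableMul G] {μ : Measure G} [μ.IsMulLeftInvariant] (χ : G →ₜ* Circle) {h : G}
    (hχ : χ h ≠ 1) : ∫ x, (χ x : ℂ) ∂μ = 0 := by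
  have key := integral_mul_left_eq_self (μ := μ) (fun x ↦ (χ x : ℂ)) h
  simp only [map_mul, Circle.coe_mul, integral_const_mul] at key
  by_contra h0
  exact hχ (Circle.coe_eq_one.1 ((mul_eq_right₀ h0).1 key))

/-- A closed subgroup of a compact second countable group is everything if it is not annihilated by
any nontrivial element of a point-separating group of characters. -/
theorem Subgroup.eq_top_of_forall_character {G : Type*} [Group G] [TopologicalSpace G]
    [IsTopologicalGroup G] [CompactSpace G] [T2Space G] [SecondCountableTopology G]
    (S : Subgroup (G →ₜ* Circle)) (hsep : ∀ x y : G, x ≠ y → ∃ χ ∈ S, χ x ≠ χ y)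
    (H : Subgroup G) (hH : IsClosed (H : Set G))
    (hS : ∀ χ ∈ S, (∀ x ∈ H, χ x = 1) → χ = 1) : H = ⊤ := by
  let : MeasurableSpace G := borel G
  have : BorelSpace G := ⟨rfl⟩
  have : CompactSpace H := isCompact_iff_compactSpace.1 hH.isCompact
  let μ : Measure G := Measure.haarMeasure ⊤
  let ν : Measure H := Measure.haarMeasure ⊤
  have : IsProbabilityMeasure μ := ⟨Measure.haarMeasure_self⟩
  have : IsProbabilityMeasure ν := ⟨Measure.haarMeasure_self⟩
  have hval : Measurable (Subtype.val : H → G) := measurable_subtype_coe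
  have : IsProbabilityMeasure (ν.map Subtype.val) :=
    Measure.isProbabilityMeasure_map hval.aemeasurable
  have hμν : μ = ν.map Subtype.val := by
    let := TopologicalSpace.pseudoMetrizableSpacePseudoMetric G
    refine ext_of_forall_integral_character_eq S hsep fun χ hχ ↦ ?_
    rw [integral_map hval.aemeasurable
      (f := fun x ↦ (χ x : ℂ))
      (continuous_subtype_val.comp χ.continuous_toFun).aestronglyMeasurable]
    by_cases h1 : χ = 1
    · simp [h1]
    obtain ⟨x, hx, hne⟩ : ∃ x ∈ H, χ x ≠ 1 := by
      by_contra! hc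
      exact h1 (hS χ hχ hc)
    rw [integral_character_eq_zero χ hne]
    exact (integral_character_eq_zero
      (χ.comp ⟨H.subtype, continuous_subtype_val⟩) (h := ⟨x, hx⟩) hne).symm
  have hzero : μ (H : Set G)ᶜ = 0 := by
    rw [hμν, Measure.map_apply hval hH.measurableSet.compl]
    convert measure_empty (μ := ν)
    ext x
    simp
  have hempty := (hH.isOpen_compl.measure_eq_zero_iff μ).1 hzero
  exact SetLike.coe_injective (by simpa using hempty)

/-- Every element of the group generated by the coordinate characters of a torus is a monomial with
integer exponents. -/
theorem exists_finsupp_prod_of_mem_closure_coordinates {ι : Type*} {χ : (ι → Circle) →ₜ* Circle}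
    (hχ : χ ∈ Subgroup.closure (Set.range fun i : ι ↦
      (⟨Pi.evalMonoidHom _ i, continuous_apply i⟩ : (ι → Circle) →ₜ* Circle))) :
    ∃ m : ι →₀ ℤ, ∀ z, χ z = m.prod fun i k ↦ z i ^ k := by
  induction hχ using Subgroup.closure_induction with
  | mem χ h =>
    obtain ⟨i, rfl⟩ := h
    exact ⟨.single i 1, fun z ↦ by simp; rfl⟩
  | one => exact ⟨0, fun z ↦ by simp⟩
  | mul χ ψ _ _ h₁ h₂ =>
    obtain ⟨m, hm⟩ := h₁
    obtain ⟨k, hk⟩ := h₂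
    refine ⟨m + k, fun z ↦ ?_⟩
    rw [Finsupp.prod_add_index' (by simp) (by simp [zpow_add]), ← hm, ← hk]
    rfl
  | inv χ _ h =>
    obtain ⟨m, hm⟩ := h
    refine ⟨-m, fun z ↦ ?_⟩
    rw [Finsupp.prod_neg_index (by simp)]
    simp only [zpow_neg, Finsupp.prod_inv]
    rw [← hm]
    rfl

/-- Kronecker's theorem for linear flows: a flow on a countable-dimensional torus with rationally
independent frequency vectors has dense orbits. -/
theorem denseRange_exp_sum_mul {ι κ : Type*} [Countable ι] [Fintype κ] (ω : ι → κ → ℝ)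
    (hω : LinearIndependent ℚ ω) :
    DenseRange fun (t : κ → ℝ) (i : ι) ↦ Circle.exp (∑ k, t k * ω i k) := by
  let φ : Multiplicative (κ → ℝ) →* (ι → Circle) :=
    { toFun t i := Circle.exp (∑ k, t.toAdd k * ω i k)
      map_one' := by ext; simp
      map_mul' s t := by
        funext i
        simp [add_mul, Finset.sum_add_distrib] }
  have htop : φ.range.topologicalClosure = ⊤ := by
    refine Subgroup.eq_top_of_forall_character (Subgroup.closure (Set.range fun i : ι ↦
      (⟨Pi.evalMonoidHom _ i, continuous_apply i⟩ : (ι → Circle) →ₜ* Circle))) ?_ _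
      (Subgroup.isClosed_topologicalClosure _) ?_
    · intro x y hxy
      obtain ⟨i, hi⟩ := Function.ne_iff.1 hxy
      exact ⟨_, Subgroup.subset_closure ⟨i, rfl⟩, hi⟩
    · intro χ hχ h
      obtain ⟨m, hm⟩ := exists_finsupp_prod_of_mem_closure_coordinates hχ
      suffices hm0 : m = 0 by
        ext z
        simp [hm, hm0]
      by_contra hm0
      have hv : m.sum (fun i k ↦ k • ω i) ≠ 0 := by
        intro hv
        have := linearIndependent_iff.1 (hω.restrict_scalars' ℤ) m
        exact hm0 (this (by simpa [Finsupp.linearCombination_apply] using hv))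
      set v := m.sum (fun i k ↦ k • ω i) with v_def
      have hvv : ∑ k, v k * v k ≠ 0 := fun h0 ↦ hv <| by
        funext k
        simpa using (Finset.sum_eq_zero_iff_of_nonneg fun k _ ↦ mul_self_nonneg (v k)).1 h0 k
          (Finset.mem_univ k)
      let t : κ → ℝ := fun k ↦ Real.pi / (∑ k, v k * v k) * v k
      have ht : ∑ k, t k * v k = Real.pi := by
        simp only [t, mul_assoc, ← Finset.mul_sum]
        exact div_mul_cancel₀ _ hvv
      have hχt := h (φ (.ofAdd t)) (Subgroup.le_topologicalClosure _ ⟨_, rfl⟩)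
      have hexp : χ (φ (.ofAdd t)) = Circle.exp (∑ k, t k * v k) := by
        rw [hm]
        simp only [v_def, Finsupp.sum, Finset.sum_apply, Pi.smul_apply, Finset.mul_sum]
        rw [Finset.sum_comm]
        refine .trans ?_ (map_sum Circle.expHom _ _).symm
        refine Finset.prod_congr rfl fun i _ ↦ ?_
        change Circle.exp (∑ k, t k * ω i k) ^ m i = Circle.exp _
        rw [← Circle.exp_zsmul, Finset.smul_sum]
        simp only [mul_smul_comm]
      rw [hexp, ht] at hχt
      exact Circle.exp_pi_ne_one hχt
  exact dense_iff_closure_eq.2 (congrArg SetLike.coe htop)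

/-- Lemma 2.1: for a ℚ-linearly independent sequence (ω_ℓ) in ℝⁿ, the additive
subgroup `{x : ℕ → ℝ | x ℓ = ⟨t, ω ℓ⟩ + 2π p ℓ}` is dense in the product space ℝ^ℕ. -/
theorem dense_kronecker_subgroup (n : ℕ) (hn : 1 ≤ n) (ω : ℕ → Fin n → ℝ)
    (hω : LinearIndependent ℚ ω) :
    Dense {x : ℕ → ℝ | ∃ (t : Fin n → ℝ) (p : ℕ → ℤ),
      ∀ ℓ : ℕ, x ℓ = (∑ k, t k * ω ℓ k) + 2 * Real.pi * (p ℓ : ℝ)} := by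
  have hopen : IsOpenMap (Pi.map fun _ : ℕ ↦ (Circle.exp : ℝ → Circle)) :=
    IsOpenMap.piMap (fun _ ↦ isLocalHomeomorph_circleExp.isOpenMap)
      (.of_forall fun _ ↦ Circle.exp_surjective)
  refine (Dense.preimage (denseRange_exp_sum_mul ω hω) hopen).mono ?_
  rintro x ⟨t, ht⟩
  choose p hp using fun ℓ ↦ Circle.exp_eq_exp.1 (congrFun ht ℓ).symm
  exact ⟨t, p, fun ℓ ↦ by rw [hp ℓ]; ring⟩
end

section
/- Let Ω ⊆ ℝ^n be nonempty, open and convex, let F = (f_1,…,f_m) be an exponential-sum mapping, let (t_s) be a sequence in ℝ^n, and let G : T_Ω → ℂ^m be such that the translates z ↦ F(z + t_s) converge to G uniformly on T_{Ω'} for every Ω' ⋐ Ω. Then there exists a character χ of ℝ^n such that G(z) = F_χ(z) for all z ∈ T_Ω. -/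
open Complex

/-- The exponential sum with spectrum `S` and coefficients `a`:
`z ↦ ∑_{λ ∈ S} a(λ) e^{i⟨z,λ⟩}`. -/
noncomputable def expComp {n : ℕ} (S : Finset (Fin n → ℝ)) (a : (Fin n → ℝ) → ℂ)
    (z : Fin n → ℂ) : ℂ :=
  ∑ l ∈ S, a l * Complex.exp (Complex.I * ∑ k, z k * (l k : ℂ))

/-- The tube `T_Ω = {z ∈ ℂⁿ : Im z ∈ Ω}`. -/
def tube {n : ℕ} (Ω : Set (Fin n → ℝ)) : Set (Fin n → ℂ) :=
  {z | (fun k => (z k).im) ∈ Ω}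

/-- Along any ultrafilter, the characters `v ↦ e^{i⟨t_s,v⟩}` converge pointwise to a character. -/
theorem exists_character_tendsto {ι : Type*} {n : ℕ} (u : Ultrafilter ι) (t : ι → Fin n → ℝ) :
    ∃ χ : (Fin n → ℝ) → Circle, (∀ v w, χ (v + w) = χ v * χ w) ∧
      ∀ v, Filter.Tendsto (fun s => Circle.exp (∑ k, t s k * v k)) u (nhds (χ v)) := by
  have hlim (v : Fin n → ℝ) :
      ∃ c, Filter.Tendsto (fun s => Circle.exp (∑ k, t s k * v k)) u (nhds c) :=
    ⟨_, (u.map fun s => Circle.exp (∑ k, t s k * v k)).le_nhds_lim⟩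
  choose χ hχ using hlim
  refine ⟨χ, fun v w => tendsto_nhds_unique (hχ (v + w)) ?_, hχ⟩
  simpa only [Pi.add_apply, mul_add, Finset.sum_add_distrib, Circle.exp_add]
    using (hχ v).mul (hχ w)

theorem expComp_add_ofReal {n : ℕ} (S : Finset (Fin n → ℝ)) (a : (Fin n → ℝ) → ℂ)
    (z : Fin n → ℂ) (t : Fin n → ℝ) :
    expComp S a (fun k => z k + (t k : ℂ)) =
      expComp S (fun l => a l * (Circle.exp (∑ k, t k * l k) : ℂ)) z := by
  refine Finset.sum_congr rfl fun l _ => ?_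
  rw [mul_assoc, Circle.coe_exp, ← Complex.exp_add]
  congr 2
  simp only [add_mul, Finset.sum_add_distrib]
  push_cast
  ring

/-- Uniform convergence on compactly based subtubes implies pointwise convergence. -/
theorem tendsto_of_forall_subtube {n : ℕ} {κ : Type*} {Ω : Set (Fin n → ℝ)} (hΩo : IsOpen Ω)
    {f : ℕ → κ → (Fin n → ℂ) → ℂ} {G : κ → (Fin n → ℂ) → ℂ}
    (hG : ∀ Ω' : Set (Fin n → ℝ), IsOpen Ω' → IsCompact (closure Ω') → closure Ω' ⊆ Ω →
      ∀ ε > 0, ∃ N : ℕ, ∀ s ≥ N, ∀ z ∈ tube Ω', ∀ ℓ, ‖f s ℓ z - G ℓ z‖ < ε)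
    (ℓ : κ) {z : Fin n → ℂ} (hz : z ∈ tube Ω) :
    Filter.Tendsto (fun s => f s ℓ z) Filter.atTop (nhds (G ℓ z)) := by
  obtain ⟨r, hr, hball⟩ := Metric.nhds_basis_closedBall.mem_iff.mp (hΩo.mem_nhds hz)
  refine Metric.tendsto_atTop.mpr fun ε hε => ?_
  obtain ⟨N, hN⟩ := hG (Metric.ball _ r) Metric.isOpen_ball
    ((isCompact_closedBall _ r).of_isClosed_subset isClosed_closure
      Metric.closure_ball_subset_closedBall)
    (Metric.closure_ball_subset_closedBall.trans hball) ε hε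
  exact ⟨N, fun s hs => by
    simpa only [dist_eq_norm] using hN s hs z (Metric.mem_ball_self hr) ℓ⟩

/-- One inclusion of Lemma 3.1: if the translates `z ↦ F(z + t_s)` of an
exponential-sum mapping converge to `G` uniformly on every compactly based
subtube of `T_Ω`, then `G = F_χ` on `T_Ω` for some character `χ` of `ℝⁿ`. -/
theorem limit_of_translates_is_perturbation (n m : ℕ)
    (Ω : Set (Fin n → ℝ)) (hΩne : Ω.Nonempty) (hΩo : IsOpen Ω) (hΩconv : Convex ℝ Ω)
    (S : Fin m → Finset (Fin n → ℝ)) (hS : ∀ ℓ, (S ℓ).Nonempty)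
    (a : Fin m → (Fin n → ℝ) → ℂ) (ha : ∀ ℓ, ∀ l ∈ S ℓ, a ℓ l ≠ 0)
    (t : ℕ → Fin n → ℝ) (G : Fin m → (Fin n → ℂ) → ℂ)
    (hG : ∀ Ω' : Set (Fin n → ℝ), IsOpen Ω' → IsCompact (closure Ω') → closure Ω' ⊆ Ω →
      ∀ ε > 0, ∃ N : ℕ, ∀ s ≥ N, ∀ z ∈ tube Ω', ∀ ℓ : Fin m,
        ‖expComp (S ℓ) (a ℓ) (fun k => z k + (t s k : ℂ)) - G ℓ z‖ < ε) :
    ∃ χ : (Fin n → ℝ) → ℂ, (∀ v, ‖χ v‖ = 1) ∧ (∀ v w, χ (v + w) = χ v * χ w) ∧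
      ∀ ℓ : Fin m, ∀ z ∈ tube Ω, G ℓ z = expComp (S ℓ) (fun l => a ℓ l * χ l) z := by
  obtain ⟨χ, hadd, hχ⟩ := exists_character_tendsto (Filter.hyperfilter ℕ) t
  refine ⟨fun v => (χ v : ℂ), fun v => Circle.norm_coe _,
    fun v w => (congrArg _ (hadd v w)).trans (Circle.coe_mul _ _), fun ℓ z hz => ?_⟩
  refine tendsto_nhds_unique
    ((tendsto_of_forall_subtube hΩo hG ℓ hz).mono_left Nat.hyperfilter_le_atTop) ?_
  simp only [expComp_add_ofReal]
  exact tendsto_finsetSum _ fun l _ =>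
    (((continuous_subtype_val.tendsto (χ l)).comp (hχ l)).const_mul _).mul_const _
end

section
/- Let Ω ⊆ ℝ^n be nonempty, open and convex, let F = (f_1,…,f_m) be an exponential-sum mapping, and let χ be a character of ℝ^n. Then there exists a sequence (t_s) in ℝ^n such that the translates z ↦ F(z + t_s) converge to F_χ uniformly on T_{Ω'} for every Ω' ⋐ Ω. -/
open Complex

/-- The continuous character `l ↦ e^{i⟨t,l⟩}` of `ℝⁿ`. -/
noncomputable def expChar {n : ℕ} (t : Fin n → ℝ) : AddChar (Fin n → ℝ) ℂ where
  toFun l := exp (I * (t ⬝ᵥ l : ℝ))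
  map_zero_eq_one' := by simp
  map_add_eq_mul' l m := by rw [dotProduct_add, ofReal_add, mul_add, exp_add]

lemma expChar_apply {n : ℕ} (t l : Fin n → ℝ) : expChar t l = exp (I * (t ⬝ᵥ l : ℝ)) := rfl

lemma expChar_add_left {n : ℕ} (s t l : Fin n → ℝ) :
    expChar (s + t) l = expChar s l * expChar t l := by
  simp only [expChar_apply, add_dotProduct, ofReal_add, mul_add, exp_add]

lemma norm_expChar {n : ℕ} (t l : Fin n → ℝ) : ‖expChar t l‖ = 1 := by
  rw [expChar_apply, mul_comm, norm_exp_ofReal_mul_I]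

lemma exists_expChar_eq_neg_one {n : ℕ} {l : Fin n → ℝ} (hl : l ≠ 0) :
    ∃ t, expChar t l = -1 := by
  have h : l ⬝ᵥ l ≠ 0 := fun h => hl (dotProduct_self_eq_zero.1 h)
  refine ⟨(Real.pi / (l ⬝ᵥ l)) • l, ?_⟩
  rw [expChar_apply, smul_dotProduct, smul_eq_mul, div_mul_cancel₀ _ h, mul_comm, exp_pi_mul_I]

/-- The constant term of a trigonometric polynomial is bounded by its supremum. -/
lemma norm_constant_term_le {n : ℕ} {ι : Type*} (J : Finset ι) (μ : ι → Fin n → ℝ)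
    (hμ : ∀ i ∈ J, μ i ≠ 0) (c₀ : ℂ) (c : ι → ℂ) {A : ℝ}
    (hA : ∀ t, ‖c₀ + ∑ i ∈ J, c i * expChar t (μ i)‖ ≤ A) : ‖c₀‖ ≤ A := by
  classical
  induction J using Finset.induction_on generalizing c with
  | empty => simpa using hA 0
  | insert j J hj ih =>
    obtain ⟨s, hs⟩ := exists_expChar_eq_neg_one (hμ j (Finset.mem_insert_self j J))
    refine ih (fun i hi => hμ i (Finset.mem_insert_of_mem hi))
      (fun i => c i * ((1 + expChar s (μ i)) / 2)) fun t => ?_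
    have key : c₀ + ∑ i ∈ J, c i * ((1 + expChar s (μ i)) / 2) * expChar t (μ i)
        = ((c₀ + ∑ i ∈ insert j J, c i * expChar t (μ i))
          + (c₀ + ∑ i ∈ insert j J, c i * expChar (s + t) (μ i))) / 2 := by
      simp only [Finset.sum_insert hj, expChar_add_left, hs]
      have : ∑ i ∈ J, c i * ((1 + expChar s (μ i)) / 2) * expChar t (μ i)
          = (∑ i ∈ J, c i * expChar t (μ i)
            + ∑ i ∈ J, c i * (expChar s (μ i) * expChar t (μ i))) / 2 := by
        rw [← Finset.sum_add_distrib, Finset.sum_div]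
        exact Finset.sum_congr rfl fun i _ => by ring
      rw [this]
      ring
    rw [key, norm_div, Complex.norm_two, div_le_iff₀ two_pos]
    exact (norm_add_le _ _).trans (by linarith [hA t, hA (s + t)])

lemma card_piAntidiag_le {ι : Type*} [DecidableEq ι] (s : Finset ι) (k : ℕ) :
    (s.piAntidiag k).card ≤ (k + 1) ^ s.card := by
  have h : (s.piAntidiag k).card ≤ (s.pi fun _ => Finset.range (k + 1)).card := by
    refine Finset.card_le_card_of_injOn (fun f i _ => f i) (fun f hf => ?_) fun f hf g hg h => ?_
    · obtain ⟨hf, -⟩ := Finset.mem_piAntidiag.1 hf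
      refine Finset.mem_pi.2 fun i hi => Finset.mem_range.2 (Nat.lt_succ_of_le ?_)
      exact hf ▸ Finset.single_le_sum (fun _ _ => Nat.zero_le _) hi
    · have hf := (Finset.mem_piAntidiag.1 hf).2
      have hg := (Finset.mem_piAntidiag.1 hg).2
      funext i
      by_cases hi : i ∈ s
      · exact congrFun (congrFun h i) hi
      · rw [not_imp_comm.1 (hf i) hi, not_imp_comm.1 (hg i) hi]
  simpa using h

/-- Each multinomial coefficient is at most `A ^ k` when the twisted sum of characters is bounded
by `A`, because grouping equal frequencies in its `k`-th power produces no cancellation. -/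
lemma multinomial_le_of_forall_norm_sum_le {n : ℕ} (χ : AddChar (Fin n → ℝ) ℂ)
    (hχ : ∀ v, ‖χ v‖ = 1) (S : Finset (Fin n → ℝ)) {A : ℝ}
    (hA : ∀ t, ‖∑ l ∈ S, χ l * expChar t l‖ ≤ A) {k : ℕ} {p : (Fin n → ℝ) → ℕ}
    (hp : p ∈ S.piAntidiag k) : (Nat.multinomial S p : ℝ) ≤ A ^ k := by
  classical
  let σ : ((Fin n → ℝ) → ℕ) → Fin n → ℝ := fun q => ∑ l ∈ S, q l • l
  let P := S.piAntidiag k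
  have expand (ψ : AddChar (Fin n → ℝ) ℂ) :
      ψ (-σ p) * (∑ l ∈ S, ψ l) ^ k
        = ∑ q ∈ P, (Nat.multinomial S q : ℂ) * ψ (σ q - σ p) := by
    rw [Finset.sum_pow_eq_sum_piAntidiag, Finset.mul_sum]
    refine Finset.sum_congr rfl fun q _ => ?_
    have : ψ (σ q) = ∏ l ∈ S, ψ l ^ q l := by
      simp only [σ, ← AddChar.map_nsmul_eq_pow]
      exact map_prod ψ.toMonoidHom (fun l => Multiplicative.ofAdd (q l • l)) S
    rw [sub_eq_neg_add, AddChar.map_add_eq_mul, this]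
    ring
  have hle : ‖((∑ q ∈ P with σ q = σ p, Nat.multinomial S q : ℕ) : ℂ)‖ ≤ A ^ k := by
    refine norm_constant_term_le (P.filter fun q => σ q ≠ σ p) (fun q => σ q - σ p)
      (fun q hq => sub_ne_zero.2 (Finset.mem_filter.1 hq).2) _
      (fun q => Nat.multinomial S q * χ (σ q - σ p)) fun t => ?_
    have h : ((∑ q ∈ P with σ q = σ p, Nat.multinomial S q : ℕ) : ℂ)
        + ∑ q ∈ P with σ q ≠ σ p, Nat.multinomial S q * χ (σ q - σ p) * expChar t (σ q - σ p)
        = (χ * expChar t) (-σ p) * (∑ l ∈ S, (χ * expChar t) l) ^ k := by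
      rw [expand, ← Finset.sum_filter_add_sum_filter_not P (fun q => σ q = σ p), Nat.cast_sum]
      congr 1
      · refine Finset.sum_congr rfl fun q hq => ?_
        rw [(Finset.mem_filter.1 hq).2, sub_self, AddChar.map_zero_eq_one, mul_one]
      · exact Finset.sum_congr rfl fun q _ => by rw [AddChar.mul_apply, mul_assoc]
    rw [h, norm_mul, norm_pow, AddChar.mul_apply, norm_mul, hχ, norm_expChar, one_mul, one_mul]
    exact pow_le_pow_left₀ (norm_nonneg _) (hA t) k
  rw [Complex.norm_natCast] at hle
  refine le_trans (Nat.cast_le.2 ?_) hle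
  exact Finset.single_le_sum (f := fun q => Nat.multinomial S q) (fun _ _ => Nat.zero_le _)
    (Finset.mem_filter.2 ⟨hp, rfl⟩)

lemma card_pow_le_of_forall_norm_sum_le {n : ℕ} (χ : AddChar (Fin n → ℝ) ℂ)
    (hχ : ∀ v, ‖χ v‖ = 1) (S : Finset (Fin n → ℝ)) {A : ℝ}
    (hA : ∀ t, ‖∑ l ∈ S, χ l * expChar t l‖ ≤ A) (k : ℕ) :
    (S.card : ℝ) ^ k ≤ ((k : ℝ) + 1) ^ S.card * A ^ k := by
  classical
  have hA0 : 0 ≤ A := (norm_nonneg _).trans (hA 0)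
  have h := Finset.sum_pow_eq_sum_piAntidiag S (fun _ => (1 : ℝ)) k
  simp only [one_pow, Finset.prod_const_one, mul_one, Finset.sum_const, nsmul_eq_mul] at h
  rw [h]
  refine (Finset.sum_le_card_nsmul _ _ (A ^ k) fun p hp =>
    multinomial_le_of_forall_norm_sum_le χ hχ S hA hp).trans ?_
  rw [nsmul_eq_mul]
  exact mul_le_mul_of_nonneg_right (mod_cast card_piAntidiag_le S k) (pow_nonneg hA0 k)

lemma exists_lt_norm_sum {n : ℕ} (χ : AddChar (Fin n → ℝ) ℂ)
    (hχ : ∀ v, ‖χ v‖ = 1) (S : Finset (Fin n → ℝ)) {A : ℝ} (hA : A < S.card) :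
    ∃ t, A < ‖∑ l ∈ S, χ l * expChar t l‖ := by
  by_contra! h
  have hA0 : 0 ≤ A := (norm_nonneg _).trans (h 0)
  have hN : (0 : ℝ) < S.card := hA0.trans_lt hA
  obtain ⟨B, hAB, hBN⟩ := exists_between hA
  have hB : 0 < B := hA0.trans_lt hAB
  set r := B / S.card with hr
  have hr0 : 0 < r := div_pos hB hN
  have hr1 : |r| < 1 := by rwa [abs_of_pos hr0, div_lt_one hN]
  have hlim := (Filter.tendsto_add_atTop_iff_nat 1).2
    (tendsto_pow_const_mul_const_pow_of_abs_lt_one S.card hr1)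
  obtain ⟨k, hk⟩ := (hlim.eventually_lt_const hr0).exists
  have hle := card_pow_le_of_forall_norm_sum_le χ hχ S (fun t => (h t).trans hAB.le) k
  have hBr : B = r * S.card := by rw [hr, div_mul_cancel₀ _ hN.ne']
  rw [hBr, mul_pow, ← mul_assoc, le_mul_iff_one_le_left (pow_pos hN k)] at hle
  rw [Nat.cast_add, Nat.cast_one, pow_succ, ← mul_assoc] at hk
  nlinarith

/-- **Kronecker's theorem** for arbitrary characters: on finite sets, every character of `ℝⁿ` is a
limit of continuous ones. -/
lemma exists_forall_norm_expChar_sub_lt {n : ℕ} (χ : AddChar (Fin n → ℝ) ℂ)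
    (hχ : ∀ v, ‖χ v‖ = 1) (S : Finset (Fin n → ℝ)) {ε : ℝ} (hε : 0 < ε) :
    ∃ t, ∀ l ∈ S, ‖expChar t l - χ l‖ < ε := by
  classical
  have hχ' : ∀ v, ‖χ⁻¹ v‖ = 1 := fun v => by rw [AddChar.inv_apply, hχ]
  set T := insert 0 S
  have h0T : (0 : Fin n → ℝ) ∈ T := Finset.mem_insert_self _ _
  obtain ⟨t, ht⟩ := exists_lt_norm_sum χ⁻¹ hχ' T
    (sub_lt_self (T.card : ℝ) (by positivity : 0 < ε ^ 2 / 4))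
  refine ⟨t, fun l hl => ?_⟩
  rcases eq_or_ne l 0 with rfl | hl0
  · simpa using hε
  set ψ := χ⁻¹ * expChar t
  have hψ : ∀ v, ‖ψ v‖ = 1 := fun v => by
    rw [AddChar.mul_apply, norm_mul, hχ', norm_expChar, one_mul]
  have hlT : l ∈ T.erase 0 := Finset.mem_erase.2 ⟨hl0, Finset.mem_insert_of_mem hl⟩
  have hcard : (((T.erase 0).erase l).card : ℝ) + 2 = T.card := by
    have h1 := Finset.card_erase_add_one h0T
    have h2 := Finset.card_erase_add_one hlT
    exact_mod_cast (by omega : ((T.erase 0).erase l).card + 2 = T.card)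
  have hsum : ‖∑ v ∈ T, ψ v‖ ≤ ‖1 + ψ l‖ + (((T.erase 0).erase l).card : ℝ) := by
    rw [← Finset.add_sum_erase _ _ h0T, ← Finset.add_sum_erase _ _ hlT, ← add_assoc,
      AddChar.map_zero_eq_one]
    refine (norm_add_le _ _).trans (add_le_add_right ((norm_sum_le _ _).trans ?_) _)
    simp [hψ]
  have hplus : 2 - ε ^ 2 / 4 < ‖1 + ψ l‖ := by
    change _ < ‖∑ v ∈ T, ψ v‖ at ht
    linarith
  have hpar := parallelogram_law_with_norm ℝ (1 : ℂ) (ψ l)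
  rw [hψ, norm_one] at hpar
  have hlt : ‖1 - ψ l‖ < ε := by
    refine lt_of_pow_lt_pow_left₀ 2 hε.le ?_
    have := norm_nonneg (1 + ψ l)
    rcases le_or_gt (2 - ε ^ 2 / 4) 0 with h | h <;> nlinarith [norm_nonneg (1 - ψ l)]
  have hfac : χ l - expChar t l = χ l * (1 - ψ l) := by
    have hne : χ l ≠ 0 := norm_ne_zero_iff.1 (by rw [hχ]; exact one_ne_zero)
    rw [AddChar.mul_apply, AddChar.inv_apply, AddChar.map_neg_eq_inv]
    field_simp
  rwa [norm_sub_rev, hfac, norm_mul, hχ, one_mul]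

lemma expComp_translate {n : ℕ} (S : Finset (Fin n → ℝ)) (a : (Fin n → ℝ) → ℂ)
    (z : Fin n → ℂ) (t : Fin n → ℝ) :
    expComp S a (fun k => z k + (t k : ℂ)) = expComp S (fun l => a l * expChar t l) z := by
  refine Finset.sum_congr rfl fun l _ => ?_
  simp only [add_mul, Finset.sum_add_distrib, mul_add, exp_add, expChar_apply, dotProduct,
    ofReal_sum, ofReal_mul]
  ring

lemma norm_exp_I_mul_sum {n : ℕ} (z : Fin n → ℂ) (l : Fin n → ℝ) :
    ‖exp (I * ∑ k, z k * (l k : ℂ))‖ = Real.exp (-((fun k => (z k).im) ⬝ᵥ l)) := by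
  simp [norm_exp, dotProduct]

/-- The sum of the absolute values of the terms of an exponential sum, as a function of `Im z`. -/
noncomputable def expMajorant {n : ℕ} (S : Finset (Fin n → ℝ)) (a : (Fin n → ℝ) → ℂ)
    (y : Fin n → ℝ) : ℝ :=
  ∑ l ∈ S, ‖a l‖ * Real.exp (-(y ⬝ᵥ l))

lemma expMajorant_nonneg {n : ℕ} (S : Finset (Fin n → ℝ)) (a : (Fin n → ℝ) → ℂ)
    (y : Fin n → ℝ) : 0 ≤ expMajorant S a y :=
  Finset.sum_nonneg fun _ _ => by positivity

lemma continuous_expMajorant {n : ℕ} (S : Finset (Fin n → ℝ)) (a : (Fin n → ℝ) → ℂ) :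
    Continuous (expMajorant S a) := by
  unfold expMajorant dotProduct
  fun_prop

lemma norm_expComp_sub_le {n : ℕ} (S : Finset (Fin n → ℝ)) (a φ ψ : (Fin n → ℝ) → ℂ) {δ : ℝ}
    (h : ∀ l ∈ S, ‖φ l - ψ l‖ ≤ δ) (z : Fin n → ℂ) :
    ‖expComp S (fun l => a l * φ l) z - expComp S (fun l => a l * ψ l) z‖
      ≤ expMajorant S a (fun k => (z k).im) * δ := by
  rw [expComp, expComp, ← Finset.sum_sub_distrib, expMajorant, Finset.sum_mul]
  refine norm_sum_le_of_le _ fun l hl => ?_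
  rw [← sub_mul, ← mul_sub, norm_mul, norm_mul, norm_exp_I_mul_sum, mul_right_comm]
  exact mul_le_mul_of_nonneg_left (h l hl) (by positivity)

/-- The other inclusion of Lemma 3.1: for every character `χ` of `ℝⁿ` there is a
sequence `(t_s)` in `ℝⁿ` such that the translates `z ↦ F(z + t_s)` converge to
the perturbed mapping `F_χ` uniformly on every compactly based subtube of `T_Ω`. -/
theorem perturbation_is_limit_of_translates (n m : ℕ)
    (Ω : Set (Fin n → ℝ)) (hΩne : Ω.Nonempty) (hΩo : IsOpen Ω) (hΩconv : Convex ℝ Ω)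
    (S : Fin m → Finset (Fin n → ℝ)) (hS : ∀ ℓ, (S ℓ).Nonempty)
    (a : Fin m → (Fin n → ℝ) → ℂ) (ha : ∀ ℓ, ∀ l ∈ S ℓ, a ℓ l ≠ 0)
    (χ : (Fin n → ℝ) → ℂ)
    (hχ1 : ∀ v, ‖χ v‖ = 1)
    (hχadd : ∀ v w, χ (v + w) = χ v * χ w) :
    ∃ t : ℕ → Fin n → ℝ,
      ∀ Ω' : Set (Fin n → ℝ), IsOpen Ω' → IsCompact (closure Ω') → closure Ω' ⊆ Ω →
        ∀ ε > 0, ∃ N : ℕ, ∀ s ≥ N, ∀ z ∈ tube Ω', ∀ ℓ : Fin m,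
          ‖expComp (S ℓ) (a ℓ) (fun k => z k + (t s k : ℂ))
            - expComp (S ℓ) (fun l => a ℓ l * χ l) z‖ < ε := by
  classical
  have hχ0 : χ 0 = 1 := by
    have hne : χ 0 ≠ 0 := norm_ne_zero_iff.1 (by rw [hχ1]; exact one_ne_zero)
    have h := hχadd 0 0
    rw [add_zero] at h
    exact (mul_eq_left₀ hne).1 h.symm
  let X : AddChar (Fin n → ℝ) ℂ := ⟨χ, hχ0, hχadd⟩
  choose t ht using fun s : ℕ => exists_forall_norm_expChar_sub_lt X hχ1 (Finset.univ.biUnion S)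
    (Nat.one_div_pos_of_nat : (0 : ℝ) < 1 / ((s : ℝ) + 1))
  refine ⟨t, fun Ω' _ hΩ' _ ε hε => ?_⟩
  obtain ⟨C, hC⟩ := hΩ'.bddAbove_image (f := fun y => ∑ ℓ, expMajorant (S ℓ) (a ℓ) y)
    (continuous_finsetSum _ fun ℓ _ => continuous_expMajorant (S ℓ) (a ℓ)).continuousOn
  have hC1 : 0 < max C 1 := zero_lt_one.trans_le (le_max_right _ _)
  obtain ⟨N, hN⟩ := exists_nat_one_div_lt (div_pos hε hC1)
  refine ⟨N, fun s hs z hz ℓ => ?_⟩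
  have hmaj : expMajorant (S ℓ) (a ℓ) (fun k => (z k).im) ≤ max C 1 :=
    (Finset.single_le_sum (f := fun ℓ => expMajorant (S ℓ) (a ℓ) (fun k => (z k).im))
      (fun _ _ => expMajorant_nonneg _ _ _) (Finset.mem_univ ℓ)).trans
      ((hC ⟨_, subset_closure hz, rfl⟩).trans (le_max_left _ _))
  rw [expComp_translate]
  calc _ ≤ expMajorant (S ℓ) (a ℓ) (fun k => (z k).im) * (1 / ((s : ℝ) + 1)) :=
        norm_expComp_sub_le (S ℓ) (a ℓ) (expChar (t s)) χ (fun l hl =>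
          (ht s l (Finset.mem_biUnion.2 ⟨ℓ, Finset.mem_univ ℓ, hl⟩)).le) z
    _ ≤ max C 1 * (1 / ((s : ℝ) + 1)) := by gcongr
    _ < max C 1 * (ε / max C 1) :=
        mul_lt_mul_of_pos_left ((Nat.one_div_le_one_div hs).trans_lt hN) hC1
    _ = ε := mul_div_cancel₀ _ hC1.ne'
end

section
/- Let Ω ⊆ ℝ^n be nonempty, open and convex, let F = (f_1,…,f_m) be an exponential-sum mapping, and let η ∈ Ω. Then there exist a character χ of ℝ^n and a point ξ ∈ ℝ^n with F_χ(ξ + iη) = 0 if and only if there exists a character χ' of ℝ^n with F_{χ'}(iη) = 0. -/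
open Complex

/-- Translating an exponential sum by a real vector `ξ` amounts to perturbing its coefficients
by the continuous character `l ↦ e^{i⟨ξ,l⟩}`. -/
theorem expComp_ofReal_add {n : ℕ} (S : Finset (Fin n → ℝ)) (a : (Fin n → ℝ) → ℂ)
    (ξ : Fin n → ℝ) (z : Fin n → ℂ) :
    expComp S a (fun k => (ξ k : ℂ) + z k) =
      expComp S (fun l => a l * Complex.exp (((∑ k, ξ k * l k : ℝ) : ℂ) * Complex.I)) z := by
  refine Finset.sum_congr rfl fun l _ => ?_
  rw [mul_assoc, ← Complex.exp_add]
  simp only [add_mul, Finset.sum_add_distrib, Complex.ofReal_sum, Complex.ofReal_mul]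
  ring_nf

/-- Equation (15) of Theorem 4.1 (for exponential-sum mappings): a point `η ∈ Ω`
is the imaginary part of a zero of some perturbation `F_χ` if and only if `iη`
itself is a zero of some perturbation `F_{χ'}`. -/
theorem yamoeba_purely_imaginary_points (n m : ℕ)
    (Ω : Set (Fin n → ℝ)) (hΩne : Ω.Nonempty) (hΩo : IsOpen Ω) (hΩconv : Convex ℝ Ω)
    (S : Fin m → Finset (Fin n → ℝ)) (hS : ∀ ℓ, (S ℓ).Nonempty)
    (a : Fin m → (Fin n → ℝ) → ℂ) (ha : ∀ ℓ, ∀ l ∈ S ℓ, a ℓ l ≠ 0)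
    (η : Fin n → ℝ) (hη : η ∈ Ω) :
    (∃ χ : (Fin n → ℝ) → ℂ, (∀ v, ‖χ v‖ = 1) ∧ (∀ v w, χ (v + w) = χ v * χ w) ∧
        ∃ ξ : Fin n → ℝ, ∀ ℓ : Fin m,
          expComp (S ℓ) (fun l => a ℓ l * χ l)
            (fun k => (ξ k : ℂ) + Complex.I * (η k : ℂ)) = 0)
    ↔ (∃ χ' : (Fin n → ℝ) → ℂ, (∀ v, ‖χ' v‖ = 1) ∧ (∀ v w, χ' (v + w) = χ' v * χ' w) ∧
        ∀ ℓ : Fin m,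
          expComp (S ℓ) (fun l => a ℓ l * χ' l)
            (fun k => Complex.I * (η k : ℂ)) = 0) := by
  constructor
  · rintro ⟨χ, hnorm, hmul, ξ, hzero⟩
    refine ⟨fun l => χ l * Complex.exp (((∑ k, ξ k * l k : ℝ) : ℂ) * Complex.I),
      fun v => ?_, fun v w => ?_, fun ℓ => ?_⟩
    · rw [norm_mul, hnorm, Complex.norm_exp_ofReal_mul_I, one_mul]
    · have hsum : ∑ k, ξ k * (v + w) k = ∑ k, ξ k * v k + ∑ k, ξ k * w k := by
        simp only [Pi.add_apply, mul_add, Finset.sum_add_distrib]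
      simp only [hsum, hmul, Complex.ofReal_add, add_mul, Complex.exp_add]
      ring
    · simpa only [expComp_ofReal_add, mul_assoc] using hzero ℓ
  · rintro ⟨χ, hnorm, hmul, hzero⟩
    exact ⟨χ, hnorm, hmul, 0, fun ℓ => by simpa using hzero ℓ⟩
end

section
/- Let Ω ⊆ ℝ^n be nonempty, open and convex, and let F = (f_1,…,f_m) be an exponential-sum mapping. Then the 𝒴-amoeba 𝒴_F = {η ∈ Ω : there exist a character χ of ℝ^n and ξ ∈ ℝ^n with F_χ(ξ + iη) = 0} is a closed subset of Ω (closed in the subspace topology of Ω). -/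
open Complex

/-- The unit-modulus characters of `ℝ^n`, not necessarily continuous. -/
def unitCharacters (n : ℕ) : Set ((Fin n → ℝ) → ℂ) :=
  {χ | (∀ v, ‖χ v‖ = 1) ∧ ∀ v w, χ (v + w) = χ v * χ w}

/-- The unit-modulus characters are compact for the topology of pointwise convergence. -/
theorem isCompact_unitCharacters (n : ℕ) : IsCompact (unitCharacters n) := by
  refine (isCompact_univ_pi fun _ : Fin n → ℝ => isCompact_sphere (0 : ℂ) 1).of_isClosed_subset
    ?_ fun χ hχ v _ => by simpa using hχ.1 v
  simp only [unitCharacters, Set.ofPred_and, Set.ofPred_forall]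
  exact (isClosed_iInter fun v => isClosed_eq (by fun_prop) (by fun_prop)).inter
    (isClosed_iInter fun v => isClosed_iInter fun w => isClosed_eq (by fun_prop) (by fun_prop))

/-- Twisting a character by the continuous character `v ↦ e^{i⟨ξ,v⟩}` gives a character. -/
theorem mul_exp_mem_unitCharacters {n : ℕ} {χ : (Fin n → ℝ) → ℂ} (hχ : χ ∈ unitCharacters n)
    (ξ : Fin n → ℝ) :
    (fun v => χ v * Complex.exp (Complex.I * ∑ k, (ξ k : ℂ) * (v k : ℂ))) ∈ unitCharacters n := by
  refine ⟨fun v => ?_, fun v w => ?_⟩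
  · have h := Complex.norm_exp_I_mul_ofReal (∑ k, ξ k * v k)
    push_cast at h
    rw [norm_mul, hχ.1, h, one_mul]
  · simp only [hχ.2 v w, Pi.add_apply, Complex.ofReal_add, mul_add, Finset.sum_add_distrib,
      Complex.exp_add]
    ring

/-- A translation of the argument is a twist of the coefficients. -/
theorem expComp_add {n : ℕ} (S : Finset (Fin n → ℝ)) (a : (Fin n → ℝ) → ℂ) (z w : Fin n → ℂ) :
    expComp S a (fun k => z k + w k) =
      expComp S (fun l => a l * Complex.exp (Complex.I * ∑ k, z k * (l k : ℂ))) w := by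
  simp only [expComp, add_mul, Finset.sum_add_distrib, mul_add, Complex.exp_add, mul_assoc]

/-- Closedness assertion of Theorem 4.1 (for exponential-sum mappings): the
𝒴-amoeba `{η ∈ Ω | ∃ χ, ξ, F_χ(ξ + iη) = 0}` is closed in the subspace
topology of `Ω`. -/
theorem yamoeba_isClosed (n m : ℕ)
    (Ω : Set (Fin n → ℝ)) (hΩne : Ω.Nonempty) (hΩo : IsOpen Ω) (hΩconv : Convex ℝ Ω)
    (S : Fin m → Finset (Fin n → ℝ)) (hS : ∀ ℓ, (S ℓ).Nonempty)
    (a : Fin m → (Fin n → ℝ) → ℂ) (ha : ∀ ℓ, ∀ l ∈ S ℓ, a ℓ l ≠ 0) :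
    IsClosed {η : Ω | ∃ χ : (Fin n → ℝ) → ℂ,
      (∀ v, ‖χ v‖ = 1) ∧ (∀ v w, χ (v + w) = χ v * χ w) ∧
      ∃ ξ : Fin n → ℝ, ∀ ℓ : Fin m,
        expComp (S ℓ) (fun l => a ℓ l * χ l)
          (fun k => (ξ k : ℂ) + Complex.I * ((η : Fin n → ℝ) k : ℂ)) = 0} := by
  have : CompactSpace (unitCharacters n) :=
    isCompact_iff_compactSpace.mp (isCompact_unitCharacters n)
  let T : Set (unitCharacters n × Ω) := {p | ∀ ℓ : Fin m,
    expComp (S ℓ) (fun l => a ℓ l * p.1.1 l) (fun k => Complex.I * ((p.2 : Fin n → ℝ) k : ℂ)) = 0}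
  have hT : IsClosed T := by
    simp only [T, Set.ofPred_forall]
    refine isClosed_iInter fun ℓ => isClosed_eq ?_ continuous_const
    have hχ (l : Fin n → ℝ) : Continuous fun p : unitCharacters n × Ω => p.1.1 l :=
      (continuous_apply l).comp (continuous_subtype_val.comp continuous_fst)
    have hη (k : Fin n) : Continuous fun p : unitCharacters n × Ω => (p.2 : Fin n → ℝ) k :=
      (continuous_apply k).comp (continuous_subtype_val.comp continuous_snd)
    unfold expComp
    fun_prop
  convert isClosedMap_snd_of_compactSpace T hT using 1
  ext η
  constructor
  · rintro ⟨χ, h1, h2, ξ, h⟩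
    refine ⟨(⟨_, mul_exp_mem_unitCharacters ⟨h1, h2⟩ ξ⟩, η), fun ℓ => ?_, rfl⟩
    simpa only [expComp_add, mul_assoc] using h ℓ
  · rintro ⟨⟨χ, η⟩, h, rfl⟩
    refine ⟨χ.1, χ.2.1, χ.2.2, 0, fun ℓ => ?_⟩
    simpa using h ℓ
end

section
/- Let Ω ⊆ ℝ^n be nonempty, open and convex, and let f : T_Ω → ℂ be holomorphic and almost periodic, i.e. for every ε > 0 and every Ω' ⋐ Ω there exists t ∈ (0,∞)^n such that for each ξ ∈ ℝ^n there is τ ∈ ℝ^n with |τ_k − ξ_k| < t_k for all 1 ≤ k ≤ n and sup_{z∈T_{Ω'}} |f(z+τ) − f(z)| < ε. Let g : T_Ω → ℂ and let (t_s) be a sequence in ℝ^n such that z ↦ f(z + t_s) converges to g uniformly on T_{Ω'} for every Ω' ⋐ Ω. Then the amoebae of f and g coincide: the closure in ℝ^n of Im{z ∈ T_Ω : f(z) = 0} equals the closure in ℝ^n of Im{z ∈ T_Ω : g(z) = 0}. -/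
open Complex

open Metric Filter Topology

/-- A holomorphic function on a disc whose modulus at the centre is smaller than its modulus on
the boundary circle has a zero. -/
theorem exists_mem_closedBall_eq_zero {F : ℂ → ℂ} {c : ℂ} {R m : ℝ} (hR : 0 < R) (hm : 0 < m)
    (hF : DifferentiableOn ℂ F (closedBall c R)) (hs : ∀ z ∈ sphere c R, m ≤ ‖F z‖)
    (hc : ‖F c‖ < m) : ∃ z ∈ closedBall c R, F z = 0 := by
  by_contra! h
  have hd : DiffContOnCl ℂ (fun z => (F z)⁻¹) (ball c R) :=
    (DifferentiableOn.inv hF h).diffContOnCl_ball subset_rfl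
  have key := norm_le_of_forall_mem_frontier_norm_le isBounded_ball hd (C := m⁻¹)
    (fun z hz => by
      rw [frontier_ball c hR.ne'] at hz
      rw [norm_inv]
      exact inv_anti₀ hm (hs z hz)) (subset_closure (mem_ball_self hR))
  rw [norm_inv] at key
  have hpos : 0 < ‖F c‖ := norm_pos_iff.2 (h c (mem_closedBall_self hR.le))
  exact absurd ((inv_le_inv₀ hpos hm).1 key) (not_le.2 hc)

/-- The complex line `ζ ↦ z + ζ v` in `ℂⁿ`. -/
def complexLine {n : ℕ} (z v : Fin n → ℂ) (ζ : ℂ) : Fin n → ℂ := z + ζ • v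

theorem differentiable_complexLine {n : ℕ} (z v : Fin n → ℂ) :
    Differentiable ℂ (complexLine z v) := by
  unfold complexLine; fun_prop

theorem complexLine_add {n : ℕ} (z v a : Fin n → ℂ) (ζ : ℂ) :
    complexLine z v ζ + a = complexLine (z + a) v ζ := by
  simp only [complexLine]; abel

theorem continuous_imPart {n : ℕ} : Continuous (fun z : Fin n → ℂ => fun k => (z k).im) := by
  fun_prop

theorem isOpen_tube {n : ℕ} {Ω : Set (Fin n → ℝ)} (hΩ : IsOpen Ω) : IsOpen (tube Ω) :=
  hΩ.preimage continuous_imPart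

theorem convex_tube {n : ℕ} {Ω : Set (Fin n → ℝ)} (hΩ : Convex ℝ Ω) : Convex ℝ (tube Ω) := by
  intro z hz w hw a b ha hb hab
  have h := hΩ hz hw ha hb hab
  simp only [tube, Set.mem_ofPred_eq] at h ⊢
  convert h using 1
  ext k
  simp

theorem add_ofReal_mem_tube_iff {n : ℕ} {Ω : Set (Fin n → ℝ)} (z : Fin n → ℂ) (a : Fin n → ℝ) :
    (fun k => z k + (a k : ℂ)) ∈ tube Ω ↔ z ∈ tube Ω := by
  simp [tube]

theorem convex_preimage_complexLine {n : ℕ} {Ω : Set (Fin n → ℝ)} (hΩ : Convex ℝ Ω)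
    (z v : Fin n → ℂ) : Convex ℝ (complexLine z v ⁻¹' tube Ω) := by
  intro x hx y hy a b ha hb hab
  have h := convex_tube hΩ hx hy ha hb hab
  simp only [Set.mem_preimage]
  convert h using 1
  ext k
  have hab' : (a : ℂ) + b = 1 := by exact_mod_cast hab
  simp only [complexLine, Pi.add_apply, Pi.smul_apply, smul_eq_mul, Complex.real_smul]
  linear_combination (-(z k)) * hab'

/-- The restrictions of `f` to the traces of complex lines on `T_Ω` are holomorphic. -/
def HolomorphicOnLines {n : ℕ} (Ω : Set (Fin n → ℝ)) (f : (Fin n → ℂ) → ℂ) : Prop :=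
  ∀ z v : Fin n → ℂ, DifferentiableOn ℂ (f ∘ complexLine z v) (complexLine z v ⁻¹' tube Ω)

/-- Near every point of `Ω`, the translates of `f` by `t s` converge to `g`, uniformly on the
tube over a neighbourhood of the point. -/
def TranslatesTendsto {n : ℕ} (Ω : Set (Fin n → ℝ)) (f g : (Fin n → ℂ) → ℂ)
    (t : ℕ → Fin n → ℝ) : Prop :=
  ∀ y ∈ Ω, ∃ r > 0, ball y r ⊆ Ω ∧ ∀ ε > 0, ∃ N : ℕ, ∀ s ≥ N, ∀ z ∈ tube (ball y r),
    ‖f (fun k => z k + (t s k : ℂ)) - g z‖ < ε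

theorem TranslatesTendsto.symm {n : ℕ} {Ω : Set (Fin n → ℝ)} {f g : (Fin n → ℂ) → ℂ}
    {t : ℕ → Fin n → ℝ} (h : TranslatesTendsto Ω f g t) :
    TranslatesTendsto Ω g f (fun s => -t s) := by
  intro y hy
  obtain ⟨r, hr, hsub, hc⟩ := h y hy
  refine ⟨r, hr, hsub, fun ε hε => ?_⟩
  obtain ⟨N, hN⟩ := hc ε hε
  refine ⟨N, fun s hs z hz => ?_⟩
  have := hN s hs _ ((add_ofReal_mem_tube_iff z (-t s)).2 hz)
  rw [norm_sub_rev]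
  simpa using this

theorem HolomorphicOnLines.translate {n : ℕ} {Ω : Set (Fin n → ℝ)} {f : (Fin n → ℂ) → ℂ}
    (hf : HolomorphicOnLines Ω f) (a : Fin n → ℝ) :
    HolomorphicOnLines Ω (fun z => f (fun k => z k + (a k : ℂ))) := by
  intro z v
  have hline (ζ : ℂ) : (fun k => complexLine z v ζ k + (a k : ℂ)) =
      complexLine (fun k => z k + (a k : ℂ)) v ζ :=
    complexLine_add z v (fun k => (a k : ℂ)) ζ
  have hset : complexLine z v ⁻¹' tube Ω =
      complexLine (fun k => z k + (a k : ℂ)) v ⁻¹' tube Ω := by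
    ext ζ
    rw [Set.mem_preimage, Set.mem_preimage, ← hline, add_ofReal_mem_tube_iff]
  rw [hset]
  refine (hf (fun k => z k + (a k : ℂ)) v).congr fun ζ _ => ?_
  simp only [Function.comp_apply, hline]

theorem TranslatesTendsto.holomorphicOnLines {n : ℕ} {Ω : Set (Fin n → ℝ)} (hΩ : IsOpen Ω)
    {f g : (Fin n → ℂ) → ℂ} {t : ℕ → Fin n → ℝ} (h : TranslatesTendsto Ω f g t)
    (hf : HolomorphicOnLines Ω f) : HolomorphicOnLines Ω g := by
  intro z v
  have hcont := (differentiable_complexLine z v).continuous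
  have hU : IsOpen (complexLine z v ⁻¹' tube Ω) := (isOpen_tube hΩ).preimage hcont
  refine TendstoLocallyUniformlyOn.differentiableOn (φ := atTop)
    (F := fun s ζ => f (fun k => complexLine z v ζ k + (t s k : ℂ))) ?_
    (Eventually.of_forall fun s => hf.translate (t s) z v) hU
  rw [Metric.tendstoLocallyUniformlyOn_iff]
  intro ε hε ζ hζ
  obtain ⟨r, hr, -, hc⟩ := h _ hζ
  obtain ⟨N, hN⟩ := hc ε hε
  refine ⟨complexLine z v ⁻¹' tube (ball (fun k => (complexLine z v ζ k).im) r),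
    mem_nhdsWithin_of_mem_nhds
      (((isOpen_tube isOpen_ball).preimage hcont).mem_nhds (mem_ball_self hr)), ?_⟩
  filter_upwards [eventually_ge_atTop N] with s hs w hw
  rw [dist_comm, dist_eq_norm]
  exact hN s hs _ hw

theorem TranslatesTendsto.eq_zero {n : ℕ} {Ω : Set (Fin n → ℝ)} {f g : (Fin n → ℂ) → ℂ}
    {t : ℕ → Fin n → ℝ} (h : TranslatesTendsto Ω f g t) (hg : ∀ z ∈ tube Ω, g z = 0)
    {z : Fin n → ℂ} (hz : z ∈ tube Ω) : f z = 0 := by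
  obtain ⟨r, hr, -, hc⟩ := h.symm _ hz
  refine norm_le_zero_iff.1 (le_of_forall_pos_le_add fun ε hε => ?_)
  obtain ⟨N, hN⟩ := hc ε hε
  have := hN N le_rfl z (mem_ball_self hr)
  rw [hg _ ((add_ofReal_mem_tube_iff z _).2 hz), zero_sub, norm_neg] at this
  linarith

/-- Imaginary parts of zeros of a limit of translates of `f` are adherent to the imaginary parts
of zeros of `f`. -/
theorem TranslatesTendsto.image_zeros_subset {n : ℕ} {Ω : Set (Fin n → ℝ)} (hΩ : IsOpen Ω)
    (hconv : Convex ℝ Ω) {f g : (Fin n → ℂ) → ℂ} {t : ℕ → Fin n → ℝ}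
    (h : TranslatesTendsto Ω f g t) (hf : HolomorphicOnLines Ω f) :
    (fun z : Fin n → ℂ => fun k => (z k).im) '' {z ∈ tube Ω | g z = 0} ⊆
      closure ((fun z : Fin n → ℂ => fun k => (z k).im) '' {z ∈ tube Ω | f z = 0}) := by
  rintro _ ⟨z, ⟨hz, hgz⟩, rfl⟩
  by_cases hg : ∀ w ∈ tube Ω, g w = 0
  · exact subset_closure ⟨z, ⟨hz, h.eq_zero hg hz⟩, rfl⟩
  push Not at hg
  obtain ⟨w, hw, hgw⟩ := hg
  set L := complexLine z (w - z) with hL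
  have hL0 : L 0 = z := by simp [hL, complexLine]
  have hL1 : L 1 = w := by simp [hL, complexLine]
  have hLc : Continuous L := (differentiable_complexLine z (w - z)).continuous
  have hU : IsOpen (L ⁻¹' tube Ω) := (isOpen_tube hΩ).preimage hLc
  have hU0 : (0 : ℂ) ∈ L ⁻¹' tube Ω := by rwa [Set.mem_preimage, hL0]
  have hU1 : (1 : ℂ) ∈ L ⁻¹' tube Ω := by rwa [Set.mem_preimage, hL1]
  have hφ : DifferentiableOn ℂ (g ∘ L) (L ⁻¹' tube Ω) := h.holomorphicOnLines hΩ hf z (w - z)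
  have hφa : AnalyticOnNhd ℂ (g ∘ L) (L ⁻¹' tube Ω) := hφ.analyticOnNhd hU
  have hne : ∀ᶠ ζ in 𝓝[≠] (0 : ℂ), (g ∘ L) ζ ≠ 0 := by
    by_contra hcon
    have := hφa.eqOn_zero_of_preconnected_of_frequently_eq_zero
      (convex_preimage_complexLine hconv z (w - z)).isPreconnected hU0
      (not_eventually.1 hcon |>.mono fun _ => not_not.1) hU1
    exact hgw (by simpa [hL1] using this)
  rw [Metric.mem_closure_iff]
  intro δ hδ
  obtain ⟨r, hr, hrΩ, hc⟩ := h _ hz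
  have hV : L ⁻¹' tube (ball (fun k => (z k).im) (min r δ)) ∈ 𝓝 (0 : ℂ) := by
    refine ((isOpen_tube isOpen_ball).preimage hLc).mem_nhds ?_
    rw [Set.mem_preimage, hL0]
    exact mem_ball_self (lt_min hr hδ)
  obtain ⟨R, hR, hRV⟩ := Metric.nhds_basis_closedBall.mem_iff.1
    (inter_mem hV (eventually_nhdsWithin_iff.1 hne))
  have hsub (ζ : ℂ) (hζ : ζ ∈ closedBall (0 : ℂ) R) :
      L ζ ∈ tube (ball (fun k => (z k).im) r) :=
    ball_subset_ball (min_le_left _ _) (hRV hζ).1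
  have hsubU : closedBall (0 : ℂ) R ⊆ L ⁻¹' tube Ω := fun ζ hζ => hrΩ (hsub ζ hζ)
  obtain ⟨p, hp, hpmin⟩ := (isCompact_sphere (0 : ℂ) R).exists_isMinOn
    (NormedSpace.sphere_nonempty.2 hR.le)
    (hφ.continuousOn.mono (sphere_subset_closedBall.trans hsubU)).norm
  have hm : 0 < ‖(g ∘ L) p‖ := norm_pos_iff.2
    ((hRV (sphere_subset_closedBall hp)).2 (ne_of_mem_sphere hp hR.ne'))
  obtain ⟨N, hN⟩ := hc (‖(g ∘ L) p‖ / 2) (half_pos hm)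
  obtain ⟨ζ, hζ, hζ0⟩ := exists_mem_closedBall_eq_zero hR (half_pos hm)
    ((hf.translate (t N) z (w - z)).mono hsubU)
    (fun ζ hζ => by
      have h1 := hN N le_rfl _ (hsub ζ (sphere_subset_closedBall hζ))
      have h2 : ‖(g ∘ L) p‖ ≤ ‖(g ∘ L) ζ‖ := hpmin hζ
      have h3 := norm_sub_norm_le (g (L ζ)) (f (fun k => L ζ k + (t N k : ℂ)))
      rw [norm_sub_rev] at h3
      simp only [Function.comp_apply] at h1 h2 h3 ⊢
      linarith)
    (by
      have h1 := hN N le_rfl _ (hsub 0 (mem_closedBall_self hR.le))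
      have h0 : g (L 0) = 0 := by rw [hL0, hgz]
      rw [h0, sub_zero] at h1
      exact h1)
  refine ⟨_, ⟨fun k => L ζ k + (t N k : ℂ),
    ⟨(add_ofReal_mem_tube_iff _ _).2 (hsubU hζ), hζ0⟩, rfl⟩, ?_⟩
  have := ball_subset_ball (min_le_right r δ) (hRV hζ).1
  rw [dist_comm]
  simpa using this



/-- Corollary 4.1: the amoeba of a holomorphic almost periodic function `f` on a
tube `T_Ω` coincides with the amoeba of any limit `g` of translates of `f`
(uniformly on compactly based subtubes). -/
theorem amoeba_of_bochner_limit (n : ℕ)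
    (Ω : Set (Fin n → ℝ)) (hΩne : Ω.Nonempty) (hΩo : IsOpen Ω) (hΩconv : Convex ℝ Ω)
    (f g : (Fin n → ℂ) → ℂ)
    (hf : DifferentiableOn ℂ f (tube Ω))
    (hap : ∀ ε > 0, ∀ Ω' : Set (Fin n → ℝ),
      IsOpen Ω' → IsCompact (closure Ω') → closure Ω' ⊆ Ω →
      ∃ t : Fin n → ℝ, (∀ k, 0 < t k) ∧
        ∀ ξ : Fin n → ℝ, ∃ τ : Fin n → ℝ, (∀ k, |τ k - ξ k| < t k) ∧
          ∀ z ∈ tube Ω', ‖f (fun k => z k + (τ k : ℂ)) - f z‖ < ε)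
    (t : ℕ → Fin n → ℝ)
    (hconv : ∀ Ω' : Set (Fin n → ℝ),
      IsOpen Ω' → IsCompact (closure Ω') → closure Ω' ⊆ Ω →
      ∀ ε > 0, ∃ N : ℕ, ∀ s ≥ N, ∀ z ∈ tube Ω',
        ‖f (fun k => z k + (t s k : ℂ)) - g z‖ < ε) :
    closure ((fun z : Fin n → ℂ => fun k => (z k).im) '' {z ∈ tube Ω | f z = 0})
      = closure ((fun z : Fin n → ℂ => fun k => (z k).im) '' {z ∈ tube Ω | g z = 0}) := by
  have h : TranslatesTendsto Ω f g t := by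
    intro y hy
    obtain ⟨r, hr, hsub⟩ := Metric.nhds_basis_closedBall.mem_iff.1 (hΩo.mem_nhds hy)
    exact ⟨r, hr, ball_subset_closedBall.trans hsub,
      hconv (ball y r) isOpen_ball
        ((isCompact_closedBall y r).of_isClosed_subset isClosed_closure
          closure_ball_subset_closedBall)
        (closure_ball_subset_closedBall.trans hsub)⟩
  have hfl : HolomorphicOnLines Ω f := fun z v =>
    hf.comp (differentiable_complexLine z v).differentiableOn fun _ hζ => hζ
  have hgl : HolomorphicOnLines Ω g := h.holomorphicOnLines hΩo hfl
  exact (closure_minimal (h.symm.image_zeros_subset hΩo hΩconv hgl) isClosed_closure).antisymm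
    (closure_minimal (h.image_zeros_subset hΩo hΩconv hfl) isClosed_closure)
end

section
/- Let F = (f_1,…,f_m) be an exponential-sum mapping on ℂ^n whose spectra satisfy S_ℓ ⊆ ℚ^n for every 1 ≤ ℓ ≤ m. Then 𝒴_F = Im V(F), and Im V(F) is a closed subset of ℝ^n (hence equals the amoeba of F). -/
open Complex

/-- `Im V(F)`: the image under the componentwise imaginary part of the common
zero set of the components of the exponential-sum mapping. -/
def imZeroSet {n m : ℕ} (S : Fin m → Finset (Fin n → ℝ))
    (a : Fin m → (Fin n → ℝ) → ℂ) : Set (Fin n → ℝ) :=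
  (fun z : Fin n → ℂ => fun k => (z k).im) ''
    {z | ∀ ℓ : Fin m, expComp (S ℓ) (a ℓ) z = 0}

/-- The 𝒴-amoeba of the exponential-sum mapping with spectra `S` and
coefficients `a`: the union over all characters `χ` of `ℝⁿ` of `Im V(F_χ)`. -/
def yamoeba {n m : ℕ} (S : Fin m → Finset (Fin n → ℝ))
    (a : Fin m → (Fin n → ℝ) → ℂ) : Set (Fin n → ℝ) :=
  {η | ∃ χ : (Fin n → ℝ) → ℂ, (∀ v, ‖χ v‖ = 1) ∧ (∀ v w, χ (v + w) = χ v * χ w) ∧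
    η ∈ imZeroSet S (fun ℓ l => a ℓ l * χ l)}

/-- Finitely many rational reals have a common denominator. -/
theorem exists_common_denominator (T : Finset ℝ) (hT : ∀ x ∈ T, ∃ q : ℚ, x = (q : ℝ)) :
    ∃ N : ℕ, N ≠ 0 ∧ ∀ x ∈ T, ∃ p : ℤ, (N : ℝ) * x = p := by
  induction T using Finset.induction_on with
  | empty => exact ⟨1, one_ne_zero, by simp⟩
  | insert x T _ ih =>
    obtain ⟨N, hN, h⟩ := ih fun y hy => hT y (Finset.mem_insert_of_mem hy)
    obtain ⟨q, rfl⟩ := hT x (Finset.mem_insert_self x T)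
    refine ⟨N * q.den, mul_ne_zero hN q.den_nz, fun y hy => ?_⟩
    rcases Finset.mem_insert.1 hy with rfl | hy
    · refine ⟨N * q.num, ?_⟩
      have hq : (q.den : ℝ) * q = q.num := by exact_mod_cast Rat.den_mul_eq_num q
      push_cast
      rw [mul_assoc, hq]
    · obtain ⟨p, hp⟩ := h y hy
      refine ⟨q.den * p, ?_⟩
      push_cast
      rw [← hp]
      ring

/-- Rational spectra have a common denominator. -/
theorem exists_common_denominator_spectra {n m : ℕ} (S : Fin m → Finset (Fin n → ℝ))
    (hrat : ∀ ℓ, ∀ l ∈ S ℓ, ∀ k, ∃ q : ℚ, l k = (q : ℝ)) :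
    ∃ N : ℕ, N ≠ 0 ∧ ∀ ℓ, ∀ l ∈ S ℓ, ∀ k, ∃ p : ℤ, (N : ℝ) * l k = p := by
  classical
  obtain ⟨N, hN, h⟩ := exists_common_denominator
    (Finset.univ.biUnion fun ℓ => (S ℓ).biUnion fun l => Finset.univ.image l) (by
      intro x hx
      simp only [Finset.mem_biUnion, Finset.mem_image, Finset.mem_univ, true_and] at hx
      obtain ⟨ℓ, l, hl, k, rfl⟩ := hx
      exact hrat ℓ l hl k)
  refine ⟨N, hN, fun ℓ l hl k => h _ ?_⟩
  simp only [Finset.mem_biUnion, Finset.mem_image, Finset.mem_univ, true_and]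
  exact ⟨ℓ, l, hl, k, rfl⟩

/-- A perturbation by the continuous character `l ↦ e^{i⟨t,l⟩}` is a translation by `t`. -/
theorem expComp_mul_eq_expComp_add {n : ℕ} (S : Finset (Fin n → ℝ)) (a : (Fin n → ℝ) → ℂ)
    (χ : (Fin n → ℝ) → ℂ) (t : Fin n → ℝ)
    (hχ : ∀ l ∈ S, χ l = exp (I * ∑ k, (t k : ℂ) * (l k : ℂ))) (z : Fin n → ℂ) :
    expComp S (fun l => a l * χ l) z = expComp S a (fun k => z k + t k) := by
  refine Finset.sum_congr rfl fun l hl => ?_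
  simp only [hχ l hl, add_mul, Finset.sum_add_distrib, mul_add, exp_add]
  ring

/-- On a vector whose coordinates have denominator `N`, a unit-modulus character agrees with a
continuous one. -/
theorem exists_character_eq_exp {n : ℕ} (χ : (Fin n → ℝ) → ℂ) (hnorm : ∀ v, ‖χ v‖ = 1)
    (hadd : ∀ v w, χ (v + w) = χ v * χ w) {N : ℕ} (hN : N ≠ 0) :
    ∃ t : Fin n → ℝ, ∀ l : Fin n → ℝ, (∀ k, ∃ p : ℤ, (N : ℝ) * l k = p) →
      χ l = exp (I * ∑ k, (t k : ℂ) * (l k : ℂ)) := by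
  have hne (v) : χ v ≠ 0 := norm_ne_zero_iff.1 (by simp [hnorm])
  have hzero : χ 0 = 1 := by
    have h := hadd 0 0
    rw [add_zero] at h
    exact (mul_eq_left₀ (hne 0)).1 h.symm
  let ψ : Multiplicative (Fin n → ℝ) →* ℂˣ :=
    { toFun := fun v => Units.mk0 (χ v.toAdd) (hne _)
      map_one' := by ext; simpa using hzero
      map_mul' := fun v w => by ext; simpa using hadd _ _ }
  have hψ (v : Fin n → ℝ) : χ v = ψ (Multiplicative.ofAdd v) := rfl
  have hN' : (N : ℝ) ≠ 0 := Nat.cast_ne_zero.2 hN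
  let e (k : Fin n) : Fin n → ℝ := Pi.single k (N : ℝ)⁻¹
  refine ⟨fun k => N * arg (χ (e k)), fun l hl => ?_⟩
  choose p hp using hl
  have hl : l = ∑ k, p k • e k := by
    ext j
    simp [e, Finset.sum_apply, Pi.single_apply, ← hp]
    field_simp
  have hprod : χ l = ∏ k, χ (e k) ^ p k := by
    conv_lhs => rw [hl]
    simp only [hψ, ofAdd_sum, ofAdd_zsmul, map_prod, map_zpow, Units.coe_prod,
      Units.val_zpow_eq_zpow_val]
  rw [hprod, Finset.mul_sum, exp_sum]
  refine Finset.prod_congr rfl fun k _ => ?_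
  have harg : χ (e k) = exp (arg (χ (e k)) * I) := by
    have h := norm_mul_exp_arg_mul_I (χ (e k))
    rw [hnorm, ofReal_one, one_mul] at h
    exact h.symm
  have hpk : (N : ℂ) * l k = p k := by exact_mod_cast hp k
  conv_lhs => rw [harg]
  rw [← exp_int_mul, ← hpk]
  congr 1
  push_cast
  ring

/-- Exponential sums with spectrum in `N⁻¹ℤⁿ` are `2πN`-periodic in each variable. -/
theorem expComp_add_period {n : ℕ} (S : Finset (Fin n → ℝ)) (a : (Fin n → ℝ) → ℂ) {N : ℕ}
    (hS : ∀ l ∈ S, ∀ k, ∃ p : ℤ, (N : ℝ) * l k = p) (q : Fin n → ℤ) (z : Fin n → ℂ) :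
    expComp S a (fun k => z k + (q k * (2 * Real.pi * N) : ℝ)) = expComp S a z := by
  rw [← expComp_mul_eq_expComp_add S a (fun _ => 1) (fun k => q k * (2 * Real.pi * N))]
  · simp
  · intro l hl
    choose p hp using hS l hl
    symm
    rw [exp_eq_one_iff]
    refine ⟨∑ k, q k * p k, ?_⟩
    push_cast
    rw [Finset.mul_sum, Finset.sum_mul]
    refine Finset.sum_congr rfl fun k _ => ?_
    have hpk : (N : ℂ) * l k = p k := by exact_mod_cast hp k
    rw [← hpk]
    ring

theorem continuous_expComp {n : ℕ} (S : Finset (Fin n → ℝ)) (a : (Fin n → ℝ) → ℂ) :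
    Continuous (expComp S a) := by
  unfold expComp
  fun_prop

/-- The imaginary parts of the common zeros of exponential sums with spectra in `N⁻¹ℤⁿ` form a
closed set. -/
theorem isClosed_imZeroSet_of_common_denominator {n m : ℕ} (S : Fin m → Finset (Fin n → ℝ))
    (a : Fin m → (Fin n → ℝ) → ℂ) {N : ℕ} (hN : N ≠ 0)
    (hS : ∀ ℓ, ∀ l ∈ S ℓ, ∀ k, ∃ p : ℤ, (N : ℝ) * l k = p) :
    IsClosed (imZeroSet S a) := by
  have hpos : 0 < 2 * Real.pi * N := by positivity
  let K : Set (Fin n → ℝ) := Set.Icc 0 fun _ => 2 * Real.pi * N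
  have : CompactSpace K := isCompact_iff_compactSpace.1 isCompact_Icc
  let Z : Set (K × (Fin n → ℝ)) :=
    {w | ∀ ℓ, expComp (S ℓ) (a ℓ) (fun k => (w.1.1 k : ℂ) + w.2 k * I) = 0}
  have hZ : IsClosed Z := by
    simp only [Z, Set.ofPred_forall]
    refine isClosed_iInter fun ℓ =>
      isClosed_eq ((continuous_expComp (S ℓ) (a ℓ)).comp ?_) continuous_const
    refine continuous_pi fun k => (continuous_ofReal.comp ?_).add
      ((continuous_ofReal.comp ?_).mul continuous_const)
    · exact (continuous_apply k).comp (continuous_subtype_val.comp continuous_fst)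
    · exact (continuous_apply k).comp continuous_snd
  convert isClosedMap_snd_of_compactSpace Z hZ using 1
  ext y
  constructor
  · rintro ⟨z, hz, rfl⟩
    let x (k : Fin n) : ℝ := toIcoMod hpos 0 (z k).re
    have hx : x ∈ K :=
      ⟨fun k => (toIcoMod_mem_Ico' hpos _).1, fun k => (toIcoMod_mem_Ico' hpos _).2.le⟩
    refine ⟨(⟨x, hx⟩, fun k => (z k).im), fun ℓ => ?_, rfl⟩
    rw [← hz ℓ, ← expComp_add_period (S ℓ) (a ℓ) (hS ℓ) fun k => toIcoDiv hpos 0 (z k).re]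
    congr 1
    ext k
    apply Complex.ext <;> simp [x]
  · rintro ⟨⟨x, y⟩, hxy, rfl⟩
    exact ⟨_, hxy, by ext k; simp⟩

/-- Final assertion of Lemma 4.3: for an exponential-sum mapping with rational
spectra, `𝒴_F = Im V(F)` and `Im V(F)` is closed (hence equals the amoeba). -/
theorem yamoeba_eq_imZeroSet_of_rational_spectra (n m : ℕ)
    (S : Fin m → Finset (Fin n → ℝ)) (hS : ∀ ℓ, (S ℓ).Nonempty)
    (a : Fin m → (Fin n → ℝ) → ℂ) (ha : ∀ ℓ, ∀ l ∈ S ℓ, a ℓ l ≠ 0)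
    (hrat : ∀ ℓ, ∀ l ∈ S ℓ, ∀ k, ∃ q : ℚ, l k = (q : ℝ)) :
    yamoeba S a = imZeroSet S a ∧ IsClosed (imZeroSet S a) := by
  obtain ⟨N, hN, hden⟩ := exists_common_denominator_spectra S hrat
  refine ⟨Set.Subset.antisymm ?_ ?_, isClosed_imZeroSet_of_common_denominator S a hN hden⟩
  · rintro _ ⟨χ, hnorm, hadd, z, hz, rfl⟩
    obtain ⟨t, ht⟩ := exists_character_eq_exp χ hnorm hadd hN
    refine ⟨fun k => z k + t k, fun ℓ => ?_, by ext k; simp⟩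
    rw [← expComp_mul_eq_expComp_add (S ℓ) (a ℓ) χ t fun l hl => ht l (hden ℓ l hl)]
    exact hz ℓ
  · intro η hη
    exact ⟨fun _ => 1, by simp, by simp, by simpa using hη⟩
end

section
/- Let f be an exponential sum on ℂ^n (a single exponential-sum component) whose spectrum satisfies Sp f ⊆ ℚ^n. Then every connected component of the complement ℝ^n ∖ 𝓕_f of the amoeba 𝓕_f = closure(Im{z ∈ ℂ^n : f(z) = 0}) is a convex subset of ℝ^n. -/
open Complex

section Summability

/-- A product of nonnegative summable functions of the separate coordinates is summable. -/
theorem summable_prod_pi {β : Type*} {g : β → ℝ} (hg0 : ∀ b, 0 ≤ g b) (hg : Summable g) (n : ℕ) :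
    Summable fun μ : Fin n → β => ∏ k, g (μ k) := by
  induction n with
  | zero => exact Summable.of_finite
  | succ n ih =>
    rw [← (Fin.consEquiv fun _ : Fin (n + 1) => β).summable_iff]
    refine (hg.mul_of_nonneg ih hg0 fun μ => Finset.prod_nonneg fun k _ => hg0 _).congr ?_
    rintro ⟨b, μ⟩
    simp [Fin.consEquiv, Fin.prod_univ_succ]

theorem summable_exp_neg_mul_abs_int {ε : ℝ} (hε : 0 < ε) :
    Summable fun j : ℤ => Real.exp (-(ε * |(j : ℝ)|)) := by
  have h : Summable fun j : ℕ => Real.exp (-(ε * |(j : ℝ)|)) := by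
    refine (Real.summable_exp_nat_mul_iff.2 (neg_lt_zero.2 hε)).congr fun j => ?_
    rw [Nat.abs_cast]
    ring_nf
  refine Summable.of_nat_of_neg (by simpa using h) (by simpa using h)

theorem summable_exp_neg_mul_sum_abs {ε : ℝ} (hε : 0 < ε) (n : ℕ) :
    Summable fun μ : Fin n → ℤ => Real.exp (-(ε * ∑ k, |(μ k : ℝ)|)) := by
  refine (summable_prod_pi (fun _ => (Real.exp_pos _).le)
    (summable_exp_neg_mul_abs_int hε) n).congr fun μ => ?_
  rw [← Real.exp_sum, Finset.mul_sum, Finset.sum_neg_distrib]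

end Summability

section ParametricIntegral

open MeasureTheory Topology

/-- Differentiation under the integral sign over a compact space, for an integrand which is jointly
continuous together with its derivative in the parameter. -/
theorem hasFDerivAt_integral_of_continuousOn_compact {E K : Type*} [NormedAddCommGroup E]
    [NormedSpace ℂ E] [FiniteDimensional ℂ E] [TopologicalSpace K] [CompactSpace K]
    [SecondCountableTopology K] [MeasurableSpace K] [BorelSpace K] (ν : Measure K)
    [IsFiniteMeasure ν] {U : Set E} (hU : IsOpen U) {F : E → K → ℂ} {F' : E → K → E →L[ℂ] ℂ}
    (hF : ContinuousOn (Function.uncurry F) (U ×ˢ Set.univ))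
    (hF' : ContinuousOn (Function.uncurry F') (U ×ˢ Set.univ))
    (hd : ∀ z ∈ U, ∀ θ, HasFDerivAt (F · θ) (F' z θ) z) {z : E} (hz : z ∈ U) :
    HasFDerivAt (fun z => ∫ θ, F z θ ∂ν) (∫ θ, F' z θ ∂ν) z := by
  have : ProperSpace E := FiniteDimensional.proper ℂ E
  obtain ⟨s, hs, hsU, hsc⟩ := local_compact_nhds (hU.mem_nhds hz)
  have hFw {w : E} (hw : w ∈ U) : Continuous (F w) := by
    rw [← continuousOn_univ]
    exact hF.comp (f := fun θ => (w, θ)) (by fun_prop) fun θ _ => ⟨hw, trivial⟩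
  obtain ⟨C, hC⟩ := (hsc.prod isCompact_univ).exists_bound_of_continuousOn
    (hF'.mono (Set.prod_mono_left hsU))
  have hF'z : Continuous (F' z) := by
    rw [← continuousOn_univ]
    exact hF'.comp (f := fun θ => (z, θ)) (by fun_prop) fun θ _ => ⟨hz, trivial⟩
  refine hasFDerivAt_integral_of_dominated_of_fderiv_le (bound := fun _ => C) hs ?_ ?_ ?_ ?_
    (integrable_const _) ?_
  · filter_upwards [hU.mem_nhds hz] with w hw
    exact (hFw hw).aestronglyMeasurable
  · exact (hFw hz).integrable_of_hasCompactSupport (HasCompactSupport.of_compactSpace _)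
  · exact hF'z.aestronglyMeasurable
  · exact .of_forall fun θ w hw => hC (w, θ) ⟨hw, trivial⟩
  · exact .of_forall fun θ w hw => hd w (hsU hw) θ

end ParametricIntegral

namespace TorusSum

open MeasureTheory UnitAddTorus Topology

variable {n : ℕ}

/-- The character `e^{i⟨z,μ⟩}` of `ℂⁿ`, with the argument translated by the torus point `θ`. -/
noncomputable def char (μ : Fin n → ℤ) (z : Fin n → ℂ) (θ : UnitAddTorus (Fin n)) : ℂ :=
  exp (I * ∑ k, z k * (μ k : ℂ)) * mFourier μ θ

/-- The linear form `z ↦ i⟨z,μ⟩`. -/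
noncomputable def phase (μ : Fin n → ℤ) : (Fin n → ℂ) →L[ℂ] ℂ :=
  I • ∑ k, (μ k : ℂ) • ContinuousLinearMap.proj (R := ℂ) (φ := fun _ : Fin n => ℂ) k

theorem phase_apply (μ : Fin n → ℤ) (z : Fin n → ℂ) : phase μ z = I * ∑ k, z k * (μ k : ℂ) := by
  simp [phase, mul_comm]

theorem char_eq (μ : Fin n → ℤ) (z : Fin n → ℂ) (θ : UnitAddTorus (Fin n)) :
    char μ z θ = exp (phase μ z) * mFourier μ θ := by
  rw [char, phase_apply]

theorem char_add (μ ν : Fin n → ℤ) (z : Fin n → ℂ) (θ : UnitAddTorus (Fin n)) :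
    char (μ + ν) z θ = char μ z θ * char ν z θ := by
  simp only [char, mFourier_add, Pi.add_apply, Int.cast_add, mul_add, Finset.sum_add_distrib,
    exp_add]
  ring

theorem char_zero (z : Fin n → ℂ) (θ : UnitAddTorus (Fin n)) : char 0 z θ = 1 := by
  simp [char, mFourier_zero]

theorem norm_char (μ : Fin n → ℤ) (z : Fin n → ℂ) (θ : UnitAddTorus (Fin n)) :
    ‖char μ z θ‖ = Real.exp (-∑ k, (z k).im * μ k) := by
  have h : ‖mFourier μ θ‖ = 1 := by
    simp only [mFourier, fourier_apply, ContinuousMap.coe_mk, norm_prod, Circle.norm_coe,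
      Finset.prod_const_one]
  rw [char, norm_mul, h, mul_one, norm_exp]
  simp

theorem mFourier_apply_add (μ : Fin n → ℤ) (θ τ : UnitAddTorus (Fin n)) :
    mFourier μ (θ + τ) = mFourier μ θ * mFourier μ τ := by
  simp [mFourier, fourier_apply, smul_add, AddCircle.toCircle_add, Finset.prod_mul_distrib]

/-- A real translation of `z` amounts to a translation of the torus point. -/
theorem char_add_real (μ : Fin n → ℤ) (z : Fin n → ℂ) (t : Fin n → ℝ)
    (θ : UnitAddTorus (Fin n)) :
    char μ (fun k => z k + 2 * Real.pi * t k) θ = char μ z (θ + fun k => (t k : UnitAddCircle)) := by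
  have h : mFourier μ (fun k => (t k : UnitAddCircle)) =
      exp (I * ∑ k, (2 * Real.pi * t k) * (μ k : ℂ)) := by
    simp only [mFourier, ContinuousMap.coe_mk, fourier_coe_apply, Finset.mul_sum, exp_sum]
    refine Finset.prod_congr rfl fun k _ => ?_
    congr 1
    push_cast
    ring
  rw [char, char, mFourier_apply_add, h]
  simp only [add_mul, Finset.sum_add_distrib, mul_add, exp_add]
  ring

theorem continuous_char (μ : Fin n → ℤ) : Continuous (Function.uncurry (char μ)) := by
  unfold char Function.uncurry
  fun_prop

theorem hasFDerivAt_char (μ : Fin n → ℤ) (z : Fin n → ℂ) (θ : UnitAddTorus (Fin n)) :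
    HasFDerivAt (char μ · θ) (char μ z θ • phase μ) z := by
  simp only [char_eq]
  refine ((phase μ).hasFDerivAt (x := z)).cexp.mul_const (mFourier μ θ) |>.congr_fderiv ?_
  rw [smul_smul, mul_comm]

/-- The Haar probability measure on the torus. -/
noncomputable def haar (n : ℕ) : Measure (UnitAddTorus (Fin n)) := Measure.addHaarMeasure ⊤

instance : IsProbabilityMeasure (haar n) := ⟨Measure.addHaarMeasure_self⟩

instance : (haar n).IsAddHaarMeasure := inferInstanceAs (Measure.addHaarMeasure _).IsAddHaarMeasure

theorem integral_char (μ : Fin n → ℤ) (z : Fin n → ℂ) :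
    ∫ θ, char μ z θ ∂haar n = if μ = 0 then 1 else 0 := by
  split_ifs with h
  · simp [h, char_zero]
  · obtain ⟨k, hk⟩ := Function.ne_iff.1 h
    let τ : UnitAddTorus (Fin n) := Pi.single k ((1 / 2 / μ k : ℝ) : UnitAddCircle)
    have hτ : mFourier μ τ = -1 := by
      have h1 : ∀ j, j ≠ k → fourier (μ j) (τ j) = 1 := fun j hj => by
        simp [τ, Pi.single_eq_of_ne hj]
      have h2 : fourier (μ k) (τ k) = -1 := by
        have := fourier_add_half_inv_index (T := 1) hk one_pos 0
        simpa [τ] using this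
      simp only [mFourier, ContinuousMap.coe_mk]
      rw [Finset.prod_eq_single k (fun j _ hj => h1 j hj) (by simp), h2]
    have key : ∫ θ, char μ z θ ∂haar n = -∫ θ, char μ z θ ∂haar n := by
      rw [← integral_neg, ← integral_add_right_eq_self _ τ]
      refine integral_congr_ae (.of_forall fun θ => ?_)
      simp [char, mFourier_apply_add, hτ]
    exact self_eq_neg.1 key

variable {ι : Type*} (S : Finset ι) (a : ι → ℂ) (m : ι → Fin n → ℤ)

/-- The family of torus translates of an exponential sum with integral spectrum. -/
noncomputable def eval (z : Fin n → ℂ) (θ : UnitAddTorus (Fin n)) : ℂ :=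
  ∑ l ∈ S, a l * char (m l) z θ

theorem continuous_eval : Continuous (Function.uncurry (eval S a m)) :=
  continuous_finsetSum _ fun l _ => continuous_const.mul (continuous_char (m l))

theorem hasFDerivAt_eval (z : Fin n → ℂ) (θ : UnitAddTorus (Fin n)) :
    HasFDerivAt (eval S a m · θ) (∑ l ∈ S, a l • char (m l) z θ • phase (m l)) z :=
  HasFDerivAt.fun_sum fun l _ => (hasFDerivAt_char (m l) z θ).const_mul (a l)

theorem eval_add_real (z : Fin n → ℂ) (t : Fin n → ℝ) (θ : UnitAddTorus (Fin n)) :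
    eval S a m (fun k => z k + 2 * Real.pi * t k) θ =
      eval S a m z (θ + fun k => (t k : UnitAddCircle)) := by
  simp only [eval, char_add_real]

/-- The `μ`-th Laurent coefficient of the reciprocal of the exponential sum, computed on the
horizontal torus through `z`. -/
noncomputable def coeff (μ : Fin n → ℤ) (z : Fin n → ℂ) : ℂ :=
  ∫ θ, char (-μ) z θ * (eval S a m z θ)⁻¹ ∂haar n

theorem coeff_add_real (μ : Fin n → ℤ) (z : Fin n → ℂ) (t : Fin n → ℝ) :
    coeff S a m μ (fun k => z k + 2 * Real.pi * t k) = coeff S a m μ z := by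
  simp only [coeff, eval_add_real, char_add_real]
  exact integral_add_right_eq_self (fun θ => char (-μ) z θ * (eval S a m z θ)⁻¹) _

variable {S a m} {Ω : Set (Fin n → ℝ)}

/-- The exponential sum has no zeros in the tube over `Ω`, not even after translation. -/
def NonvanishingOn (S : Finset ι) (a : ι → ℂ) (m : ι → Fin n → ℤ) (Ω : Set (Fin n → ℝ)) : Prop :=
  ∀ z : Fin n → ℂ, (fun k => (z k).im) ∈ Ω → ∀ θ, eval S a m z θ ≠ 0

theorem nonvanishingOn_of_eval_zero
    (h : ∀ z : Fin n → ℂ, (fun k => (z k).im) ∈ Ω → eval S a m z 0 ≠ 0) :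
    NonvanishingOn S a m Ω := by
  intro z hz θ
  choose t ht using fun k => QuotientAddGroup.mk_surjective (θ k)
  have hθ : (fun k => (t k : UnitAddCircle)) = θ := funext ht
  have := eval_add_real S a m z t 0
  rw [zero_add, hθ] at this
  rw [← this]
  refine h _ ?_
  convert hz using 2 with k
  simp [← ofReal_ofNat, ← ofReal_mul]

theorem continuousOn_inv_eval (h : NonvanishingOn S a m Ω) :
    ContinuousOn (fun p : (Fin n → ℂ) × UnitAddTorus (Fin n) => (eval S a m p.1 p.2)⁻¹)
      ({z | (fun k => (z k).im) ∈ Ω} ×ˢ Set.univ) :=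
  (continuous_eval S a m).continuousOn.inv₀ fun p hp => h p.1 hp.1 p.2

theorem isOpen_tube (hΩ : IsOpen Ω) : IsOpen {z : Fin n → ℂ | (fun k => (z k).im) ∈ Ω} :=
  hΩ.preimage (by fun_prop)

theorem exists_hasFDerivAt_coeff (hΩ : IsOpen Ω) (h : NonvanishingOn S a m Ω) (μ : Fin n → ℤ)
    {z : Fin n → ℂ} (hz : (fun k => (z k).im) ∈ Ω) :
    ∃ c' : (Fin n → ℂ) →L[ℂ] ℂ, HasFDerivAt (coeff S a m μ) c' z := by
  have hinv := continuousOn_inv_eval h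
  have hchar (ν : Fin n → ℤ) : Continuous fun p : (Fin n → ℂ) × UnitAddTorus (Fin n) =>
    char ν p.1 p.2 := continuous_char ν
  refine ⟨_, hasFDerivAt_integral_of_continuousOn_compact (haar n) (isOpen_tube hΩ)
    (F' := fun z θ => char (-μ) z θ • (-((eval S a m z θ) ^ 2)⁻¹ •
      ∑ l ∈ S, a l • char (m l) z θ • phase (m l)) +
      (eval S a m z θ)⁻¹ • char (-μ) z θ • phase (-μ)) ?_ ?_ ?_ hz⟩
  · exact (hchar _).continuousOn.mul hinv
  · have hsum : Continuous fun p : (Fin n → ℂ) × UnitAddTorus (Fin n) =>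
        ∑ l ∈ S, a l • char (m l) p.1 p.2 • phase (m l) :=
      continuous_finsetSum _ fun l _ => ((hchar (m l)).smul continuous_const).const_smul (a l)
    have hphase : Continuous fun p : (Fin n → ℂ) × UnitAddTorus (Fin n) =>
        char (-μ) p.1 p.2 • phase (-μ) := (hchar (-μ)).smul continuous_const
    have hsq : ContinuousOn (fun p : (Fin n → ℂ) × UnitAddTorus (Fin n) =>
        -((eval S a m p.1 p.2) ^ 2)⁻¹) ({z | (fun k => (z k).im) ∈ Ω} ×ˢ Set.univ) := by
      simp only [← inv_pow]
      exact (hinv.pow 2).neg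
    exact ((hchar (-μ)).continuousOn.smul (hsq.smul hsum.continuousOn)).add
      (hinv.smul hphase.continuousOn)
  · intro w hw θ
    exact (hasFDerivAt_char (-μ) w θ).mul
      ((hasDerivAt_inv (h w hw θ)).comp_hasFDerivAt w (hasFDerivAt_eval S a m w θ))

theorem hasFDerivAt_coeff (hΩ : IsOpen Ω) (h : NonvanishingOn S a m Ω) (μ : Fin n → ℤ)
    {z : Fin n → ℂ} (hz : (fun k => (z k).im) ∈ Ω) :
    HasFDerivAt (coeff S a m μ) (0 : (Fin n → ℂ) →L[ℂ] ℂ) z := by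
  obtain ⟨c', hc'⟩ := exists_hasFDerivAt_coeff hΩ h μ hz
  have hreal (v : Fin n → ℝ) : c' (fun k => (v k : ℂ)) = 0 := by
    have hline : HasDerivAt (fun s : ℝ => z + s • fun k => (v k : ℂ)) (fun k => (v k : ℂ)) 0 := by
      simpa using ((hasDerivAt_id (0 : ℝ)).smul_const (fun k => (v k : ℂ))).const_add z
    have hcomp := HasFDerivAt.comp_hasDerivAt (0 : ℝ)
      (f := fun s : ℝ => z + s • fun k => (v k : ℂ)) (l := coeff S a m μ)
      (l' := c'.restrictScalars ℝ) (by simpa using hc'.restrictScalars ℝ) hline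
    have hconst : (coeff S a m μ ∘ fun s : ℝ => z + s • fun k => (v k : ℂ)) =
        fun _ => coeff S a m μ z := by
      funext s
      rw [← coeff_add_real S a m μ z fun k => s * v k / (2 * Real.pi)]
      simp only [Function.comp_apply]
      congr 1
      funext k
      have : (Real.pi : ℂ) ≠ 0 := by exact_mod_cast Real.pi_ne_zero
      simp only [Pi.add_apply, Pi.smul_apply, real_smul]
      push_cast
      field_simp
    rw [hconst] at hcomp
    exact hcomp.unique (hasDerivAt_const _ _)
  suffices c' = 0 by rwa [this] at hc'
  ext1 v
  have hv : v = (fun k => ((v k).re : ℂ)) + I • fun k => ((v k).im : ℂ) := by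
    funext k
    simp [mul_comm I, re_add_im]
  rw [hv, map_add, map_smul, hreal, hreal]
  simp

/-- The point `iy` of `ℂⁿ`. -/
noncomputable def imag : (Fin n → ℝ) →L[ℝ] (Fin n → ℂ) :=
  ContinuousLinearMap.pi fun k => (I • ofRealCLM).comp (ContinuousLinearMap.proj k)

theorem imag_apply_im (y : Fin n → ℝ) : (fun k => (imag y k).im) = y := by
  funext k
  simp [imag]

theorem coeff_eq (hΩ : IsOpen Ω) (hconn : IsPreconnected Ω) (h : NonvanishingOn S a m Ω)
    (μ : Fin n → ℤ) {y y' : Fin n → ℝ} (hy : y ∈ Ω) (hy' : y' ∈ Ω) :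
    coeff S a m μ (imag y) = coeff S a m μ (imag y') := by
  have hd : ∀ w ∈ Ω, HasFDerivAt (fun w => coeff S a m μ (imag w)) (0 : (Fin n → ℝ) →L[ℝ] ℂ) w :=
    fun w hw => by
      have := ((hasFDerivAt_coeff hΩ h μ (z := imag w)
        (by rwa [imag_apply_im])).restrictScalars ℝ).comp w imag.hasFDerivAt
      simpa using! this
  exact hΩ.is_const_of_fderiv_eq_zero (𝕜 := ℝ) hconn
    (fun w hw => (hd w hw).differentiableAt.differentiableWithinAt)
    (fun w hw => (hd w hw).fderiv) hy hy'

/-- The reciprocal relation between the exponential sum and its Laurent coefficients. -/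
theorem sum_mul_coeff (h : NonvanishingOn S a m Ω) {z : Fin n → ℂ}
    (hz : (fun k => (z k).im) ∈ Ω) (μ : Fin n → ℤ) :
    ∑ l ∈ S, a l * coeff S a m (μ - m l) z = if μ = 0 then 1 else 0 := by
  have hchar (ν : Fin n → ℤ) : Continuous fun θ => char ν z θ := by
    unfold char
    fun_prop
  have hcont : Continuous fun θ => (eval S a m z θ)⁻¹ := by
    refine Continuous.inv₀ ?_ (h z hz)
    exact continuous_finsetSum _ fun l _ => continuous_const.mul (hchar (m l))
  have hintegrable (l : ι) : Integrable
      (fun θ => a l * (char (-(μ - m l)) z θ * (eval S a m z θ)⁻¹)) (haar n) :=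
    (continuous_const.mul ((hchar _).mul hcont)).integrable_of_hasCompactSupport
      (HasCompactSupport.of_compactSpace _)
  have hint := integral_char (-μ) z
  simp only [neg_eq_zero] at hint
  rw [← hint]
  simp only [coeff, ← integral_const_mul]
  rw [← integral_finsetSum _ fun l _ => hintegrable l]
  refine integral_congr_ae (.of_forall fun θ => ?_)
  have hne := h z hz θ
  have hsum : ∑ l ∈ S, a l * (char (-(μ - m l)) z θ * (eval S a m z θ)⁻¹) =
      char (-μ) z θ * eval S a m z θ * (eval S a m z θ)⁻¹ := by
    rw [eval, Finset.mul_sum, Finset.sum_mul]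
    refine Finset.sum_congr rfl fun l _ => ?_
    rw [neg_sub, sub_eq_neg_add, char_add]
    ring
  simp only [hsum, mul_inv_cancel_right₀ hne]

/-- Exponential decay, at the point `y`, of the terms of a Laurent series with coefficients `c`. -/
def DecaysAt (c : (Fin n → ℤ) → ℂ) (y : Fin n → ℝ) : Prop :=
  ∃ M ε : ℝ, 0 ≤ M ∧ 0 < ε ∧
    ∀ μ, ‖c μ‖ ≤ M * Real.exp (∑ k, y k * μ k - ε * ∑ k, |(μ k : ℝ)|)

theorem convex_decaysAt (c : (Fin n → ℤ) → ℂ) : Convex ℝ {y | DecaysAt c y} := by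
  rintro y₀ ⟨M₀, ε₀, hM₀, hε₀, h₀⟩ y₁ ⟨M₁, ε₁, hM₁, hε₁, h₁⟩ s t hs ht hst
  refine ⟨max M₀ M₁, min ε₀ ε₁, le_max_of_le_left hM₀, lt_min hε₀ hε₁, fun μ => ?_⟩
  have habs : 0 ≤ ∑ k, |(μ k : ℝ)| := Finset.sum_nonneg fun _ _ => abs_nonneg _
  have hlin : ∑ k, (s • y₀ + t • y₁) k * μ k =
      s * ∑ k, y₀ k * μ k + t * ∑ k, y₁ k * μ k := by
    simp [add_mul, Finset.sum_add_distrib, Finset.mul_sum, mul_assoc]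
  rw [hlin]
  obtain rfl : s = 1 - t := by linarith
  rcases le_total (∑ k, y₀ k * (μ k : ℝ)) (∑ k, y₁ k * (μ k : ℝ)) with hle | hle
  · refine (h₀ μ).trans ?_
    gcongr
    · exact le_max_left _ _
    · nlinarith
    · exact min_le_left _ _
  · refine (h₁ μ).trans ?_
    gcongr
    · exact le_max_right _ _
    · nlinarith
    · exact min_le_right _ _

theorem decaysAt_coeff (hΩ : IsOpen Ω) (hconn : IsPreconnected Ω) (h : NonvanishingOn S a m Ω)
    {y₀ y : Fin n → ℝ} (hy₀ : y₀ ∈ Ω) (hy : y ∈ Ω) :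
    DecaysAt (fun μ => coeff S a m μ (imag y₀)) y := by
  obtain ⟨ε, hε, hball⟩ := Metric.nhds_basis_closedBall.mem_iff.1 (hΩ.mem_nhds hy)
  have hcont : ContinuousOn
      (fun p : (Fin n → ℝ) × UnitAddTorus (Fin n) => (eval S a m (imag p.1) p.2)⁻¹)
      (Metric.closedBall y ε ×ˢ Set.univ) := by
    refine (continuousOn_inv_eval h).comp
      (f := fun p : (Fin n → ℝ) × UnitAddTorus (Fin n) => (imag p.1, p.2))
      (by fun_prop) fun p hp => ⟨?_, trivial⟩
    rw [Set.mem_ofPred_eq, imag_apply_im]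
    exact hball hp.1
  obtain ⟨M, hM⟩ :=
    ((isCompact_closedBall y ε).prod isCompact_univ).exists_bound_of_continuousOn hcont
  have hM0 : 0 ≤ M := (norm_nonneg _).trans (hM (y, 0) ⟨Metric.mem_closedBall_self hε.le, trivial⟩)
  refine ⟨M, ε, hM0, hε, fun μ => ?_⟩
  let y' : Fin n → ℝ := fun k => y k - ε * SignType.sign (μ k : ℝ)
  have hy' : y' ∈ Metric.closedBall y ε := by
    rw [Metric.mem_closedBall, dist_pi_le_iff hε.le]
    intro k
    have hsign : |((SignType.sign (μ k : ℝ) : SignType) : ℝ)| ≤ 1 := by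
      cases SignType.sign (μ k : ℝ) <;> simp
    rw [Real.dist_eq]
    simpa [y', abs_mul, abs_of_pos hε] using mul_le_of_le_one_right hε.le hsign
  have hsum : ∑ k, y' k * μ k = ∑ k, y k * μ k - ε * ∑ k, |(μ k : ℝ)| := by
    simp only [y', sub_mul, Finset.sum_sub_distrib, Finset.mul_sum, mul_assoc, sign_mul_self]
  simp only [coeff_eq hΩ hconn h μ hy₀ (hball hy'), ← hsum]
  have hbound := norm_integral_le_of_norm_le_const (μ := haar n) (C := M * Real.exp
    (∑ k, y' k * μ k)) (f := fun θ => char (-μ) (imag y') θ * (eval S a m (imag y') θ)⁻¹)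
    (.of_forall fun θ => ?_)
  · simpa [coeff] using hbound
  · have him := fun k => congrFun (imag_apply_im y') k
    rw [norm_mul, norm_char, mul_comm]
    simp only [him, Pi.neg_apply, Int.cast_neg, mul_neg, Finset.sum_neg_distrib, neg_neg]
    gcongr
    exact hM (y', θ) ⟨hy', trivial⟩

theorem summable_of_decaysAt {c : (Fin n → ℤ) → ℂ} {z : Fin n → ℂ}
    (hc : DecaysAt c fun k => (z k).im) (θ : UnitAddTorus (Fin n)) :
    Summable fun μ => c μ * char μ z θ := by
  obtain ⟨M, ε, -, hε, h⟩ := hc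
  refine .of_norm_bounded ((summable_exp_neg_mul_sum_abs hε n).mul_left M) fun μ => ?_
  rw [norm_mul, norm_char]
  refine (mul_le_mul_of_nonneg_right (h μ) (Real.exp_pos _).le).trans_eq ?_
  rw [mul_assoc, ← Real.exp_add]
  congr 2
  ring

/-- An exponential sum with a convergent formal reciprocal does not vanish. -/
theorem eval_ne_zero_of_summable {c : (Fin n → ℤ) → ℂ}
    (hc : ∀ μ, ∑ l ∈ S, a l * c (μ - m l) = if μ = 0 then 1 else 0) {z : Fin n → ℂ}
    {θ : UnitAddTorus (Fin n)} (hs : Summable fun μ => c μ * char μ z θ) :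
    eval S a m z θ ≠ 0 := by
  have hterm (l : ι) : HasSum (fun μ => a l * c (μ - m l) * char μ z θ)
      (a l * char (m l) z θ * ∑' μ, c μ * char μ z θ) := by
    have := hs.hasSum.mul_left (a l * char (m l) z θ)
    rw [← (Equiv.subRight (m l)).hasSum_iff] at this
    refine this.congr_fun fun μ => ?_
    have hμ := char_add (m l) (μ - m l) z θ
    rw [add_sub_cancel] at hμ
    simp only [Function.comp_apply, Equiv.subRight_apply, hμ]
    ring
  have hprod := hasSum_sum (s := S) fun l _ => hterm l
  simp only [← Finset.sum_mul, hc] at hprod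
  have hone : HasSum (fun μ : Fin n → ℤ => (if μ = 0 then 1 else 0) * char μ z θ) 1 := by
    convert hasSum_single (0 : Fin n → ℤ) (f := fun μ => (if μ = 0 then 1 else 0) * char μ z θ)
      (fun μ hμ => by simp [hμ]) using 1
    simp [char_zero]
  intro h0
  have := hprod.unique hone
  rw [← eval, h0, zero_mul] at this
  exact zero_ne_one this

/-- An exponential sum with integral spectrum without zeros in the tube over a connected open set
has no zeros in the tube over its convex hull. -/
theorem eval_ne_zero_of_mem_convexHull (hΩ : IsOpen Ω) (hconn : IsPreconnected Ω)
    (h : ∀ z : Fin n → ℂ, (fun k => (z k).im) ∈ Ω → eval S a m z 0 ≠ 0) {z : Fin n → ℂ}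
    (hz : (fun k => (z k).im) ∈ convexHull ℝ Ω) : eval S a m z 0 ≠ 0 := by
  have hnv := nonvanishingOn_of_eval_zero h
  obtain ⟨y₀, hy₀⟩ := convexHull_nonempty_iff.1 ⟨_, hz⟩
  exact eval_ne_zero_of_summable
    (sum_mul_coeff hnv (z := imag y₀) (by rwa [imag_apply_im]))
    (summable_of_decaysAt (convexHull_min (fun y hy => decaysAt_coeff hΩ hconn hnv hy₀ hy)
      (convex_decaysAt _) hz) 0)

end TorusSum

theorem exists_common_denominator_s13 {n : ℕ} (S : Finset (Fin n → ℝ))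
    (hrat : ∀ l ∈ S, ∀ k, ∃ q : ℚ, l k = (q : ℝ)) :
    ∃ N : ℝ, 0 < N ∧ ∃ m : (Fin n → ℝ) → Fin n → ℤ, ∀ l ∈ S, ∀ k, N * l k = m l k := by
  choose! q hq using hrat
  let N : ℕ := ∏ l ∈ S, ∏ k, (q l k).den
  refine ⟨N, ?_, ?_⟩
  · exact_mod_cast Finset.prod_pos fun l _ => Finset.prod_pos fun k _ => (q l k).den_pos
  · have : ∀ l ∈ S, ∀ k, ∃ j : ℤ, N * l k = j := by
      intro l hl k
      obtain ⟨d, hd⟩ : (q l k).den ∣ N :=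
        (Finset.dvd_prod_of_mem (fun k => (q l k).den) (Finset.mem_univ k)).trans
          (Finset.dvd_prod_of_mem (fun l => ∏ k, (q l k).den) hl)
      refine ⟨d * (q l k).num, ?_⟩
      have hden : ((q l k).den * q l k : ℚ) = (q l k).num := Rat.den_mul_eq_num _
      rw [hq l hl k, hd]
      have hden' : ((q l k).den : ℝ) * (q l k : ℝ) = (q l k).num := by exact_mod_cast hden
      push_cast
      rw [← hden']
      ring
    choose! m hm using this
    exact ⟨m, hm⟩

/-- An exponential sum with rational spectrum without zeros in the tube over a connected open set
has no zeros in the tube over its convex hull. -/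
theorem expComp_ne_zero_of_mem_convexHull {n : ℕ} {S : Finset (Fin n → ℝ)}
    {a : (Fin n → ℝ) → ℂ} (hrat : ∀ l ∈ S, ∀ k, ∃ q : ℚ, l k = (q : ℝ))
    {Ω : Set (Fin n → ℝ)} (hΩ : IsOpen Ω) (hconn : IsPreconnected Ω)
    (h : ∀ z : Fin n → ℂ, (fun k => (z k).im) ∈ Ω → expComp S a z ≠ 0) {z : Fin n → ℂ}
    (hz : (fun k => (z k).im) ∈ convexHull ℝ Ω) : expComp S a z ≠ 0 := by
  obtain ⟨N, hN, m, hm⟩ := exists_common_denominator_s13 S hrat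
  have heval (w : Fin n → ℂ) : expComp S a (N • w) = TorusSum.eval S a m w 0 := by
    refine Finset.sum_congr rfl fun l hl => ?_
    have hone : UnitAddTorus.mFourier (m l) 0 = 1 := by simp [UnitAddTorus.mFourier]
    rw [TorusSum.char, hone, mul_one]
    congr 3
    refine Finset.sum_congr rfl fun k _ => ?_
    have : (m l k : ℂ) = N * l k := by exact_mod_cast (hm l hl k).symm
    rw [this, Pi.smul_apply, real_smul]
    ring
  have him (r : ℝ) (w : Fin n → ℂ) :
      (fun k => ((r • w) k).im) = r • fun k => (w k).im := by
    funext k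
    simp
  have hz' : z = N • N⁻¹ • z := (smul_inv_smul₀ hN.ne' z).symm
  rw [hz', heval]
  refine TorusSum.eval_ne_zero_of_mem_convexHull (Ω := (fun y => N⁻¹ • y) '' Ω) ?_ ?_ ?_ ?_
  · exact (isOpenMap_smul₀ (inv_ne_zero hN.ne')) _ hΩ
  · exact hconn.image _ (continuous_const_smul _).continuousOn
  · rintro w ⟨y, hy, hyw⟩
    rw [← heval]
    refine h _ ?_
    rw [him, ← hyw]
    simpa only [smul_inv_smul₀ hN.ne'] using hy
  · rw [him, Set.image_smul, convexHull_smul]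
    exact Set.smul_mem_smul_set hz

/-- The `m = 0` case of Lemma 5.1: the complement of the amoeba of a single
exponential sum with rational spectrum has convex connected components. -/
theorem amoeba_complement_components_convex (n : ℕ)
    (S : Finset (Fin n → ℝ)) (hS : S.Nonempty)
    (a : (Fin n → ℝ) → ℂ) (ha : ∀ l ∈ S, a l ≠ 0)
    (hrat : ∀ l ∈ S, ∀ k, ∃ q : ℚ, l k = (q : ℝ)) :
    ∀ x ∈ (closure ((fun z : Fin n → ℂ => fun k => (z k).im) ''
        {z | expComp S a z = 0}))ᶜ,
      Convex ℝ (connectedComponentIn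
        (closure ((fun z : Fin n → ℂ => fun k => (z k).im) ''
          {z | expComp S a z = 0}))ᶜ x) := by
  intro x hx
  set A := (fun z : Fin n → ℂ => fun k => (z k).im) '' {z | expComp S a z = 0} with hA
  have hopen : IsOpen (connectedComponentIn (closure A)ᶜ x) :=
    isClosed_closure.isOpen_compl.connectedComponentIn
  have hdisj : Disjoint (convexHull ℝ (connectedComponentIn (closure A)ᶜ x)) A := by
    rw [Set.disjoint_right]
    rintro _ ⟨z, hz, rfl⟩ hmem
    refine expComp_ne_zero_of_mem_convexHull hrat hopen isPreconnected_connectedComponentIn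
      (fun w hw hw0 => ?_) hmem hz
    exact connectedComponentIn_subset _ _ hw (subset_closure ⟨w, hw0, rfl⟩)
  have hsub : convexHull ℝ (connectedComponentIn (closure A)ᶜ x) ⊆
      connectedComponentIn (closure A)ᶜ x :=
    (convex_convexHull ℝ _).isPreconnected.subset_connectedComponentIn
      (subset_convexHull ℝ _ (mem_connectedComponentIn hx))
      (hdisj.closure_right hopen.convexHull).subset_compl_right
  rw [← hsub.antisymm (subset_convexHull ℝ _)]
  exact convex_convexHull ℝ _
end

section
/- Let F = (f_1,…,f_m) be an exponential-sum mapping on ℂ^n with closed spectra, i.e. for every u ∈ ℝ^n such that the affine span of M_1(u)+⋯+M_m(u) has dimension < m there exists ℓ with M_ℓ(u) a singleton. Then F is Kazarnovskii regular: for every such u there exists ε > 0 with K[F^u](z) ≥ ε for all z ∈ ℂ^n. -/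
open Complex
open scoped Classical

/-- `M(S, u)`: the set of points of the spectrum `S` on which the linear form
`⟨u, ·⟩` attains its maximum over `S` (for `u = 0` this is all of `S`). -/
noncomputable def maxFace {n : ℕ} (S : Finset (Fin n → ℝ)) (u : Fin n → ℝ) :
    Finset (Fin n → ℝ) :=
  S.filter fun l => ∀ μ ∈ S, ∑ k, u k * μ k ≤ ∑ k, u k * l k

/-- The Minkowski sum `M_1(u) + ⋯ + M_m(u)` of the maximizing faces of the
spectra in the direction `u`. -/
def minkFace {n m : ℕ} (S : Fin m → Finset (Fin n → ℝ)) (u : Fin n → ℝ) :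
    Set (Fin n → ℝ) :=
  {x | ∃ l : Fin m → Fin n → ℝ, (∀ ℓ, l ℓ ∈ maxFace (S ℓ) u) ∧ x = ∑ ℓ, l ℓ}

/-- Kazarnovskii's function `K[F^u](z) = ∑_ℓ exp(max_{λ ∈ M_ℓ(u)} ⟨Im z, λ⟩) · |f_ℓ^u(z)|`
associated with the `u`-truncation of the exponential-sum mapping. -/
noncomputable def kazFn {n m : ℕ} (S : Fin m → Finset (Fin n → ℝ))
    (a : Fin m → (Fin n → ℝ) → ℂ) (u : Fin n → ℝ) (z : Fin n → ℂ) : ℝ :=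
  ∑ ℓ, Real.exp (sSup ((fun l : Fin n → ℝ => ∑ k, (z k).im * l k) ''
      (maxFace (S ℓ) u : Set (Fin n → ℝ))))
    * ‖expComp (maxFace (S ℓ) u) (a ℓ) z‖

/-- Kazarnovskii regularity of an exponential-sum mapping: for every direction
`u` whose associated face of the Minkowski sum of the Newton polytopes has
dimension `< m`, the function `K[F^u]` is bounded below by a positive constant. -/
def KazRegular {n m : ℕ} (S : Fin m → Finset (Fin n → ℝ))
    (a : Fin m → (Fin n → ℝ) → ℂ) : Prop :=
  ∀ u : Fin n → ℝ,
    Module.finrank ℝ (affineSpan ℝ (minkFace S u)).direction < m →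
    ∃ ε > 0, ∀ z : Fin n → ℂ, ε ≤ kazFn S a u z

/-- If the maximizing face of a spectrum is a single point `l`, then the corresponding summand of
Kazarnovskii's function is the constant `‖a l‖`. -/
theorem exp_sSup_mul_norm_expComp_singleton {n : ℕ} (l : Fin n → ℝ) (a : (Fin n → ℝ) → ℂ)
    (z : Fin n → ℂ) :
    Real.exp (sSup ((fun l : Fin n → ℝ => ∑ k, (z k).im * l k) ''
      (({l} : Finset (Fin n → ℝ)) : Set (Fin n → ℝ)))) * ‖expComp {l} a z‖ = ‖a l‖ := by
  have hre : (Complex.I * ∑ k, z k * (l k : ℂ)).re = -∑ k, (z k).im * l k := by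
    simp
  simp only [Finset.coe_singleton, Set.image_singleton, csSup_singleton, expComp,
    Finset.sum_singleton, norm_mul, Complex.norm_exp, hre, Real.exp_neg]
  field_simp

/-- Lemma 6.3: an exponential-sum mapping with closed spectra (every face of the
Minkowski sum of dimension `< m` has a singleton face summand) is Kazarnovskii
regular. -/
theorem kazRegular_of_closedSpectra (n m : ℕ)
    (S : Fin m → Finset (Fin n → ℝ)) (hS : ∀ ℓ, (S ℓ).Nonempty)
    (a : Fin m → (Fin n → ℝ) → ℂ) (ha : ∀ ℓ, ∀ l ∈ S ℓ, a ℓ l ≠ 0)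
    (hclosed : ∀ u : Fin n → ℝ,
      Module.finrank ℝ (affineSpan ℝ (minkFace S u)).direction < m →
      ∃ ℓ : Fin m, (maxFace (S ℓ) u).card = 1) :
    KazRegular S a := by
  intro u hu
  obtain ⟨ℓ, hℓ⟩ := hclosed u hu
  obtain ⟨l, hl⟩ := Finset.card_eq_one.mp hℓ
  have hmem : l ∈ S ℓ :=
    (Finset.mem_filter.mp (show l ∈ maxFace (S ℓ) u from hl ▸ Finset.mem_singleton_self l)).1
  refine ⟨‖a ℓ l‖, norm_pos_iff.mpr (ha ℓ l hmem), fun z => ?_⟩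
  rw [← exp_sSup_mul_norm_expComp_singleton l (a ℓ) z, ← hl]
  exact Finset.single_le_sum
    (f := fun ℓ => Real.exp (sSup ((fun l : Fin n → ℝ => ∑ k, (z k).im * l k) ''
      (maxFace (S ℓ) u : Set (Fin n → ℝ)))) * ‖expComp (maxFace (S ℓ) u) (a ℓ) z‖)
    (fun _ _ => by positivity) (Finset.mem_univ ℓ)
end

section
/- Let 1 ≤ m ≤ n and let F = (f_1,…,f_m) be an exponential-sum mapping on ℂ^n. Define 𝒵_F = {u ∈ ℝ^n : for every 1 ≤ ℓ ≤ m the set M_ℓ(u) has at least two elements}. Then F has closed spectra if and only if the Hausdorff dimension of 𝒵_F is at most n − m. -/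
open Complex
open scoped Classical

/-- The subspace of all directions orthogonal to `V` for the standard pairing of `ℝⁿ`. -/
noncomputable def dotAnnihilator {n : ℕ} (V : Submodule ℝ (Fin n → ℝ)) :
    Submodule ℝ (Fin n → ℝ) :=
  V.dualAnnihilator.comap (dotProductEquiv ℝ (Fin n)).toLinearMap

theorem mem_dotAnnihilator {n : ℕ} {V : Submodule ℝ (Fin n → ℝ)} {w : Fin n → ℝ} :
    w ∈ dotAnnihilator V ↔ ∀ v ∈ V, w ⬝ᵥ v = 0 := by
  simp [dotAnnihilator, Submodule.mem_dualAnnihilator]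

theorem finrank_dotAnnihilator {n : ℕ} (V : Submodule ℝ (Fin n → ℝ)) :
    Module.finrank ℝ V + Module.finrank ℝ (dotAnnihilator V) = n := by
  have h : Module.finrank ℝ (dotAnnihilator V) = Module.finrank ℝ V.dualAnnihilator :=
    (LinearEquiv.ofSubmodule' (dotProductEquiv ℝ (Fin n)) V.dualAnnihilator).finrank_eq
  rw [h, Subspace.finrank_add_finrank_dualAnnihilator_eq, Module.finrank_fin_fun]

theorem dimH_submodule {E : Type*} [NormedAddCommGroup E] [NormedSpace ℝ E]
    [FiniteDimensional ℝ E] (W : Submodule ℝ E) :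
    dimH (W : Set E) = Module.finrank ℝ W := by
  have h := (isometry_subtype_coe (s := (W : Set E))).dimH_image Set.univ
  rw [Set.image_univ, Subtype.range_coe] at h
  exact h.trans (Real.dimH_univ_eq_finrank W)

theorem mem_maxFace {n : ℕ} {S : Finset (Fin n → ℝ)} {u l : Fin n → ℝ} :
    l ∈ maxFace S u ↔ l ∈ S ∧ ∀ μ ∈ S, u ⬝ᵥ μ ≤ u ⬝ᵥ l :=
  Finset.mem_filter

theorem maxFace_nonempty {n : ℕ} {S : Finset (Fin n → ℝ)} (hS : S.Nonempty) (u : Fin n → ℝ) :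
    (maxFace S u).Nonempty := by
  obtain ⟨l, hl, h⟩ := S.exists_max_image (fun l => u ⬝ᵥ l) hS
  exact ⟨l, mem_maxFace.2 ⟨hl, h⟩⟩

theorem dotProduct_eq_of_mem_maxFace {n : ℕ} {S : Finset (Fin n → ℝ)} {u l μ : Fin n → ℝ}
    (hl : l ∈ maxFace S u) (hμ : μ ∈ maxFace S u) : u ⬝ᵥ l = u ⬝ᵥ μ :=
  le_antisymm ((mem_maxFace.1 hμ).2 l (mem_maxFace.1 hl).1)
    ((mem_maxFace.1 hl).2 μ (mem_maxFace.1 hμ).1)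

/-- Every direction is orthogonal to the face of the Minkowski sum that it exposes. -/
theorem self_mem_dotAnnihilator_minkFace {n m : ℕ} (S : Fin m → Finset (Fin n → ℝ))
    (u : Fin n → ℝ) : u ∈ dotAnnihilator (vectorSpan ℝ (minkFace S u)) := by
  rw [mem_dotAnnihilator]
  suffices h : vectorSpan ℝ (minkFace S u) ≤ LinearMap.ker (dotProductEquiv ℝ (Fin n) u) by
    intro v hv
    simpa using h hv
  rw [vectorSpan_def, Submodule.span_le]
  rintro _ ⟨_, ⟨l, hl, rfl⟩, _, ⟨μ, hμ, rfl⟩, rfl⟩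
  simp only [vsub_eq_sub, SetLike.mem_coe, LinearMap.mem_ker, dotProductEquiv_apply_apply,
    dotProduct_sub, dotProduct_sum, sub_eq_zero]
  exact Finset.sum_congr rfl fun ℓ _ => dotProduct_eq_of_mem_maxFace (hl ℓ) (hμ ℓ)

theorem sub_mem_vectorSpan_minkFace {n m : ℕ} {S : Fin m → Finset (Fin n → ℝ)}
    (hS : ∀ ℓ, (S ℓ).Nonempty) {u l μ : Fin n → ℝ} {ℓ : Fin m}
    (hl : l ∈ maxFace (S ℓ) u) (hμ : μ ∈ maxFace (S ℓ) u) :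
    l - μ ∈ vectorSpan ℝ (minkFace S u) := by
  choose p hp using fun k => maxFace_nonempty (hS k) u
  have hmem : ∀ x ∈ maxFace (S ℓ) u, ∑ k, Function.update p ℓ x k ∈ minkFace S u := by
    intro x hx
    refine ⟨_, fun k => ?_, rfl⟩
    rcases eq_or_ne k ℓ with rfl | hk
    · simpa using hx
    · simpa [hk] using hp k
  have h := vsub_mem_vectorSpan ℝ (hmem l hl) (hmem μ hμ)
  simpa [Finset.sum_update_of_mem] using h

theorem eventually_maxFace_subset {n m : ℕ} {S : Fin m → Finset (Fin n → ℝ)}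
    (hS : ∀ ℓ, (S ℓ).Nonempty) (u : Fin n → ℝ) :
    ∀ᶠ w in nhds u, w ∈ dotAnnihilator (vectorSpan ℝ (minkFace S u)) →
      ∀ ℓ, maxFace (S ℓ) u ⊆ maxFace (S ℓ) w := by
  have h : ∀ᶠ w in nhds u, ∀ ℓ, ∀ l ∈ S ℓ, ∀ μ ∈ S ℓ,
      u ⬝ᵥ μ < u ⬝ᵥ l → w ⬝ᵥ μ < w ⬝ᵥ l := by
    refine Filter.eventually_all.2 fun ℓ => (Finset.eventually_all _).2 fun l _ =>
      (Finset.eventually_all _).2 fun μ _ => ?_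
    by_cases hlt : u ⬝ᵥ μ < u ⬝ᵥ l
    · have hc : ∀ v : Fin n → ℝ, Continuous fun w : Fin n → ℝ => w ⬝ᵥ v := fun v =>
        continuous_id.dotProduct continuous_const
      filter_upwards [(hc μ).continuousAt.eventually_lt (hc l).continuousAt hlt] with w hw _
      exact hw
    · exact Filter.Eventually.of_forall fun _ h => absurd h hlt
  filter_upwards [h] with w hw hann ℓ l hl
  have hl' := mem_maxFace.1 hl
  refine mem_maxFace.2 ⟨hl'.1, fun μ hμ => ?_⟩
  rcases (hl'.2 μ hμ).lt_or_eq with hlt | heq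
  · exact (hw ℓ l hl'.1 μ hμ hlt).le
  · have hμ' : μ ∈ maxFace (S ℓ) u := mem_maxFace.2 ⟨hμ, fun ν hν => heq ▸ hl'.2 ν hν⟩
    have h0 := mem_dotAnnihilator.1 hann _ (sub_mem_vectorSpan_minkFace hS hμ' hl)
    rw [dotProduct_sub, sub_eq_zero] at h0
    exact h0.le

theorem finite_range_vectorSpan_minkFace {n m : ℕ} (S : Fin m → Finset (Fin n → ℝ)) :
    (Set.range fun u : Fin n → ℝ => vectorSpan ℝ (minkFace S u)).Finite := by
  have hfin : (Set.range fun (u : Fin n → ℝ) (ℓ : Fin m) => maxFace (S ℓ) u).Finite := by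
    refine (Set.Finite.pi' fun ℓ => (S ℓ).powerset.finite_toSet).subset ?_
    rintro _ ⟨u, rfl⟩ ℓ
    exact Finset.mem_coe.2 (Finset.mem_powerset.2 (Finset.filter_subset _ _))
  refine (hfin.image fun M => vectorSpan ℝ
    {x | ∃ l : Fin m → Fin n → ℝ, (∀ ℓ, l ℓ ∈ M ℓ) ∧ x = ∑ ℓ, l ℓ}).subset ?_
  rintro _ ⟨u, rfl⟩
  exact ⟨_, ⟨u, rfl⟩, rfl⟩

/-- If no spectrum has a unique maximizer in the direction `u`, then the exceptional set is at
least as large as the normal space of the face exposed by `u`. -/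
theorem finrank_dotAnnihilator_le_dimH {n m : ℕ} {S : Fin m → Finset (Fin n → ℝ)}
    (hS : ∀ ℓ, (S ℓ).Nonempty) {u : Fin n → ℝ} (hu : ∀ ℓ, 2 ≤ (maxFace (S ℓ) u).card) :
    (Module.finrank ℝ (dotAnnihilator (vectorSpan ℝ (minkFace S u))) : ENNReal) ≤
      dimH {w : Fin n → ℝ | ∀ ℓ : Fin m, 2 ≤ (maxFace (S ℓ) w).card} := by
  set W := dotAnnihilator (vectorSpan ℝ (minkFace S u))
  set Z := {w : Fin n → ℝ | ∀ ℓ : Fin m, 2 ≤ (maxFace (S ℓ) w).card}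
  have hnhds : (Subtype.val ⁻¹' Z : Set W) ∈
      nhds (⟨u, self_mem_dotAnnihilator_minkFace S u⟩ : W) := by
    filter_upwards [continuous_subtype_val.continuousAt.eventually
      (eventually_maxFace_subset hS u)] with w hw ℓ
    exact (hu ℓ).trans (Finset.card_le_card (hw w.2 ℓ))
  have himage := (isometry_subtype_coe (s := (W : Set (Fin n → ℝ)))).dimH_image
    (Subtype.val ⁻¹' Z)
  rw [← Real.dimH_of_mem_nhds hnhds]
  exact himage.ge.trans (dimH_mono (Set.image_preimage_subset _ _))

/-- If the faces exposed by directions in a set have dimension at least `m`, then the set has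
Hausdorff dimension at most `n - m`. -/
theorem dimH_le_of_le_finrank_minkFace {n m : ℕ} (S : Fin m → Finset (Fin n → ℝ))
    {Z : Set (Fin n → ℝ)}
    (hZ : ∀ u ∈ Z, m ≤ Module.finrank ℝ (vectorSpan ℝ (minkFace S u))) :
    dimH Z ≤ (n - m : ℕ) := by
  set 𝒱 := (fun u => vectorSpan ℝ (minkFace S u)) '' Z
  have hfin : 𝒱.Finite :=
    (finite_range_vectorSpan_minkFace S).subset (Set.image_subset_range _ _)
  have hsub : Z ⊆ ⋃ V ∈ 𝒱, (dotAnnihilator V : Set (Fin n → ℝ)) := fun u hu =>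
    Set.mem_biUnion (Set.mem_image_of_mem _ hu) (self_mem_dotAnnihilator_minkFace S u)
  refine (dimH_mono hsub).trans ?_
  rw [dimH_bUnion hfin.countable]
  refine iSup₂_le ?_
  rintro _ ⟨u, hu, rfl⟩
  rw [dimH_submodule, Nat.cast_le]
  have h₁ := finrank_dotAnnihilator (vectorSpan ℝ (minkFace S u))
  have h₂ := hZ u hu
  dsimp only
  omega

/-- Lemma 6.4: an exponential-sum mapping `F` (with `1 ≤ m ≤ n`) has closed
spectra if and only if Ronkin's exceptional set
`𝒵_F = {u | every M_ℓ(u) has at least two elements}` has Hausdorff dimension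
at most `n − m`. -/
theorem closedSpectra_iff_dimH_le (n m : ℕ) (hm : 1 ≤ m) (hmn : m ≤ n)
    (S : Fin m → Finset (Fin n → ℝ)) (hS : ∀ ℓ, (S ℓ).Nonempty)
    (a : Fin m → (Fin n → ℝ) → ℂ) (ha : ∀ ℓ, ∀ l ∈ S ℓ, a ℓ l ≠ 0) :
    (∀ u : Fin n → ℝ,
      Module.finrank ℝ (affineSpan ℝ (minkFace S u)).direction < m →
      ∃ ℓ : Fin m, (maxFace (S ℓ) u).card = 1)
    ↔ dimH {u : Fin n → ℝ | ∀ ℓ : Fin m, 2 ≤ (maxFace (S ℓ) u).card}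
        ≤ (n - m : ℕ) := by
  have hdir : ∀ u, Module.finrank ℝ (affineSpan ℝ (minkFace S u)).direction =
      Module.finrank ℝ (vectorSpan ℝ (minkFace S u)) := fun u => by rw [direction_affineSpan]
  simp only [hdir]
  have hpos : ∀ u ℓ, 1 ≤ (maxFace (S ℓ) u).card := fun u ℓ =>
    (maxFace_nonempty (hS ℓ) u).card_pos
  constructor
  · intro h
    refine dimH_le_of_le_finrank_minkFace S fun u hu => ?_
    by_contra! hlt
    obtain ⟨ℓ, hℓ⟩ := h u hlt
    have := hu ℓ
    omega
  · intro h u hlt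
    by_contra! hne
    have hu : ∀ ℓ, 2 ≤ (maxFace (S ℓ) u).card := fun ℓ => by
      have h₁ := hne ℓ
      have h₂ := hpos u ℓ
      omega
    have hle := Nat.cast_le.1 ((finrank_dotAnnihilator_le_dimH hS hu).trans h)
    have hsum := finrank_dotAnnihilator (vectorSpan ℝ (minkFace S u))
    omega
end
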